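/- Let d ≥ 3 and k ≥ 5 be integers and set δ = d·k. Then there exists a homogeneous polynomial G ∈ ℂ[z_0, z_1, z_2] of degree δ such that the surface X_δ = {z_3^{δ} = G(z_0, z_1, z_2)} ⊆ ℙ³(ℂ) is smooth and Brody hyperbolic. -/

import Mathlib

open MvPolynomial

/-- The hypersurface `{F = 0} ⊆ ℙ^{q-1}(ℂ)` is Brody hyperbolic. -/
def IsBrodyHyperbolicHypersurface {q : ℕ} (F : MvPolynomial (Fin q) ℂ) : Prop :=
  ∀ f : Fin q → ℂ → ℂ,
    (∀ i, Differentiable ℂ (f i)) →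
    (∀ z : ℂ, ∃ i, f i z ≠ 0) →
    (∀ z : ℂ, MvPolynomial.eval (fun i => f i z) F = 0) →
    ∃ (c : Fin q → ℂ) (u : ℂ → ℂ), Differentiable ℂ u ∧ ∀ i z, f i z = c i * u z

/-- The hypersurface `{F = 0} ⊆ ℙ^{q-1}(ℂ)` is smooth. -/
def IsSmoothHypersurface {q : ℕ} (F : MvPolynomial (Fin q) ℂ) : Prop :=
  ∀ x : Fin q → ℂ, x ≠ 0 → MvPolynomial.eval x F = 0 →
    ∃ i, MvPolynomial.eval x (MvPolynomial.pderiv i F) ≠ 0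

section Helpers

open Metric Filter Topology Set

/-- The Wronskian of two functions. -/
noncomputable def wronsk (f g : ℂ → ℂ) (z : ℂ) : ℂ := f z * deriv g z - deriv f z * g z

theorem tendstoLocallyUniformlyOn_of_bounded {ι : Type*} {φ : Filter ι} [φ.NeBot]
    {F : ι → ℂ → ℂ} {f : ℂ → ℂ} {U : Set ℂ} {C : ℝ} (hU : IsOpen U)
    (hF : ∀ᶠ n in φ, DifferentiableOn ℂ (F n) U)
    (hC : ∀ᶠ n in φ, ∀ z ∈ U, ‖F n z‖ ≤ C)
    (hf : ∀ z ∈ U, Tendsto (fun n => F n z) φ (𝓝 (f z))) :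
    TendstoLocallyUniformlyOn F f φ U := by
  rw [Metric.tendstoLocallyUniformlyOn_iff]
  intro ε hε x hx
  obtain ⟨s, hs, hsU⟩ := Metric.isOpen_iff.1 hU x hx
  have hC0 : 0 ≤ C := by
    obtain ⟨n, hn⟩ := hC.exists
    exact (norm_nonneg _).trans (hn x hx)
  have lip : ∀ᶠ n in φ, ∀ y ∈ ball x s, dist (F n y) (F n x) ≤ (2 * C + 1) / s * dist y x := by
    filter_upwards [hF, hC] with n h1 h2 y hy
    refine Complex.dist_le_div_mul_dist_of_mapsTo_ball (h1.mono hsU) ?_ hy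
    intro w hw
    rw [mem_closedBall, dist_eq_norm]
    have := norm_sub_le (F n w) (F n x)
    linarith [h2 w (hsU hw), h2 x hx]
  have lip' : ∀ y ∈ ball x s, dist (f y) (f x) ≤ (2 * C + 1) / s * dist y x := by
    intro y hy
    refine le_of_tendsto ((hf y (hsU hy)).dist (hf x hx)) ?_
    filter_upwards [lip] with n hn using hn y hy
  set L := (2 * C + 1) / s with hL
  have hLpos : 0 < L := by positivity
  have hpos : 0 < min s (ε / (4 * L)) := by positivity
  refine ⟨ball x (min s (ε / (4 * L))), mem_nhdsWithin_of_mem_nhds (ball_mem_nhds x hpos), ?_⟩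
  filter_upwards [lip, (Metric.tendsto_nhds.1 (hf x hx)) (ε / 4) (by positivity)] with n h1 h2 y hy
  have hy1 : y ∈ ball x s := ball_subset_ball (min_le_left _ _) hy
  have hy2 : L * dist y x ≤ ε / 4 := by
    have : dist y x ≤ ε / (4 * L) := (le_of_lt hy).trans (min_le_right _ _)
    calc L * dist y x ≤ L * (ε / (4 * L)) := by gcongr
      _ = ε / 4 := by field_simp
  have t1 := lip' y hy1
  have t2 := h1 y hy1
  have := dist_triangle4 (f y) (f x) (F n x) (F n y)
  rw [dist_comm (f x), dist_comm (F n x) (F n y)] at this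
  linarith

theorem exists_rescaling_center {ρ : ℂ → ℝ} (hρ : Continuous ρ) {a : ℂ}
    (ha : 0 < ρ a) (N : ℝ) :
    ∃ z₀, 0 < ρ z₀ ∧ ∀ ζ : ℂ, ‖ζ‖ ≤ N → ρ (z₀ + ζ / ρ z₀) ≤ 2 * ρ z₀ := by
  obtain ⟨n, hn⟩ := exists_nat_gt (2 * |N| / ρ a)
  have hn0 : (0 : ℝ) < n := lt_of_le_of_lt (by positivity) hn
  rw [div_lt_iff₀ ha] at hn
  obtain ⟨z₀, hz₀, hmax⟩ := (isCompact_closedBall a (n : ℝ)).exists_isMaxOn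
    ⟨a, mem_closedBall_self hn0.le⟩
    (f := fun z => (n - dist z a) * ρ z) (by fun_prop)
  have hM : n * ρ a ≤ (n - dist z₀ a) * ρ z₀ := by
    simpa using hmax (mem_closedBall_self hn0.le : a ∈ closedBall a (n : ℝ))
  have hd : 0 ≤ n - dist z₀ a := by linarith [mem_closedBall.1 hz₀]
  have hMpos : 0 < (n - dist z₀ a) * ρ z₀ := lt_of_lt_of_le (by positivity) hM
  have hd' : 0 < n - dist z₀ a := lt_of_le_of_ne hd (fun h => by simp [← h] at hMpos)
  have hz₀pos : 0 < ρ z₀ := pos_of_mul_pos_right hMpos hd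
  refine ⟨z₀, hz₀pos, fun ζ hζ => ?_⟩
  set z := z₀ + ζ / ρ z₀
  have h1 : dist z z₀ ≤ (n - dist z₀ a) / 2 := by
    rw [dist_eq_norm z z₀]
    simp only [z, add_sub_cancel_left, norm_div, Complex.norm_real, Real.norm_eq_abs,
      abs_of_pos hz₀pos]
    rw [div_le_iff₀ hz₀pos]
    have := le_abs_self N
    linarith
  have h2 := dist_triangle z z₀ a
  have hz : z ∈ closedBall a (n : ℝ) := by
    rw [mem_closedBall]; linarith
  have h3 : (n - dist z a) * ρ z ≤ (n - dist z₀ a) * ρ z₀ := hmax hz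
  by_contra! hcon
  have : (n - dist z₀ a) / 2 * (2 * ρ z₀) < (n - dist z a) * ρ z := by
    calc _ < (n - dist z₀ a) / 2 * ρ z := by gcongr
      _ ≤ _ := by
        gcongr
        · linarith
        · linarith
  linarith

theorem norm_sq_ratio_lower_bound {ι : Type*} [Fintype ι] {g : ι → ℂ → ℂ}
    (hg : ∀ i, Differentiable ℂ (g i)) (hg0 : ∀ z, ∃ i, g i z ≠ 0) {c : ℂ} {r : ℝ}
    (hρ : ∀ z ∈ ball c r, ∑ i, ∑ j, ‖wronsk (g i) (g j) z‖ ≤ 2 * ∑ j, ‖g j z‖ ^ 2)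
    (i : ι) {z : ℂ} (hz : z ∈ ball c r) :
    ‖g i c‖ ^ 2 / (∑ j, ‖g j c‖ ^ 2) - 4 * dist z c ≤ ‖g i z‖ ^ 2 / (∑ j, ‖g j z‖ ^ 2) := by
  set S : ℂ → ℝ := fun z => ∑ j, ‖g j z‖ ^ 2 with hS
  have hSpos : ∀ z, 0 < S z := by
    intro z
    obtain ⟨k, hk⟩ := hg0 z
    exact Finset.sum_pos' (fun _ _ => by positivity) ⟨k, Finset.mem_univ _, by positivity⟩
  have hle : ∀ k z, ‖g k z‖ ^ 2 ≤ S z := fun k z =>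
    Finset.single_le_sum (f := fun j => ‖g j z‖ ^ 2) (fun _ _ => by positivity) (Finset.mem_univ k)
  set w := z - c
  set p : ℝ → ℂ := fun t => c + t * w with hp
  have hpd : ∀ t : ℝ, HasDerivAt p w t := by
    intro t
    have := (Complex.ofRealCLM.hasDerivAt (x := t)).mul_const w
    rw [Complex.ofRealCLM_apply, Complex.ofReal_one, one_mul] at this
    exact this.const_add c
  have hgd : ∀ k (t : ℝ), HasDerivAt (fun t => g k (p t)) (deriv (g k) (p t) * w) t := fun k t =>
    ((hg k (p t)).hasDerivAt).comp t (hpd t)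
  have hnd : ∀ k (t : ℝ), HasDerivAt (fun t => ‖g k (p t)‖ ^ 2)
      (2 * (inner ℝ (g k (p t)) (deriv (g k) (p t) * w))) t := fun k t => (hgd k t).norm_sq
  have hSd : ∀ t : ℝ, HasDerivAt (fun t => S (p t))
      (∑ k, 2 * (inner ℝ (g k (p t)) (deriv (g k) (p t) * w))) t := fun t =>
    HasDerivAt.fun_sum fun k _ => hnd k t
  have hqd : ∀ t : ℝ, HasDerivAt (fun t => ‖g i (p t)‖ ^ 2 / S (p t)) _ t := fun t =>
    (hnd i t).fun_div (hSd t) (hSpos _).ne'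
  have hmem : ∀ t ∈ Ico (0 : ℝ) 1, p t ∈ ball c r := by
    intro t ht
    simp only [hp, mem_ball, dist_eq_norm, add_sub_cancel_left, norm_mul, Complex.norm_real,
      Real.norm_eq_abs, abs_of_nonneg ht.1]
    rw [mem_ball, dist_eq_norm] at hz
    exact lt_of_le_of_lt (mul_le_of_le_one_left (norm_nonneg _) ht.2.le) hz
  have key := norm_image_sub_le_of_norm_deriv_le_segment_01' (C := 4 * ‖w‖)
    (fun t _ => (hqd t).hasDerivWithinAt) ?_
  · have e0 : p 0 = c := by simp [hp]
    have e1 : p 1 = z := by simp [hp, w]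
    rw [e0, e1, Real.norm_eq_abs] at key
    have := (abs_le.1 key).1
    rw [dist_eq_norm]
    change _ / S c - _ ≤ _ / S z
    linarith
  · intro t ht
    have hb := hρ _ (hmem t ht)
    set x := p t
    have num : 2 * (inner ℝ (g i x) (deriv (g i) x * w)) * S x -
        ‖g i x‖ ^ 2 * ∑ k, 2 * (inner ℝ (g k x) (deriv (g k) x * w)) =
        ∑ k, -2 * ((starRingEnd ℂ (g i x)) * (starRingEnd ℂ (g k x)) *
          wronsk (g i) (g k) x * w).re := by
      rw [hS, Finset.mul_sum, Finset.mul_sum, ← Finset.sum_sub_distrib]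
      refine Finset.sum_congr rfl fun k _ => ?_
      simp only [wronsk, Complex.inner, ← Complex.normSq_eq_norm_sq, Complex.normSq_apply,
        Complex.mul_re, Complex.mul_im, Complex.conj_re, Complex.conj_im, Complex.sub_re,
        Complex.sub_im]
      ring
    rw [num, norm_div, Real.norm_eq_abs, Real.norm_eq_abs, abs_of_pos (pow_pos (hSpos x) 2),
      div_le_iff₀ (pow_pos (hSpos x) 2)]
    calc |∑ k, -2 * ((starRingEnd ℂ (g i x)) * (starRingEnd ℂ (g k x)) *
          wronsk (g i) (g k) x * w).re|
        ≤ ∑ k, |(-2 : ℝ) * ((starRingEnd ℂ (g i x)) * (starRingEnd ℂ (g k x)) *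
          wronsk (g i) (g k) x * w).re| := Finset.abs_sum_le_sum_abs _ _
      _ ≤ ∑ k, 2 * (S x * ‖wronsk (g i) (g k) x‖ * ‖w‖) := by
          refine Finset.sum_le_sum fun k _ => ?_
          rw [abs_mul, abs_neg, abs_two]
          gcongr
          refine (Complex.abs_re_le_norm _).trans ?_
          rw [norm_mul, norm_mul, norm_mul, RCLike.norm_conj, RCLike.norm_conj]
          gcongr
          nlinarith [hle i x, hle k x, sq_nonneg (‖g i x‖ - ‖g k x‖)]
      _ = 2 * S x * ‖w‖ * ∑ k, ‖wronsk (g i) (g k) x‖ := by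
          rw [Finset.mul_sum]; exact Finset.sum_congr rfl fun k _ => by ring
      _ ≤ 2 * S x * ‖w‖ * (2 * S x) := by
          have := (hSpos x).le
          gcongr
          exact (Finset.single_le_sum (f := fun i => ∑ j, ‖wronsk (g i) (g j) x‖)
            (fun _ _ => by positivity) (Finset.mem_univ i)).trans hb
      _ = 4 * ‖w‖ * S x ^ 2 := by ring

/-- A family of local lifts, on discs of radius `r`, of a holomorphic curve in projective space;
each lift is bounded by `C` and has one coordinate equal to `1`. -/
structure BoundedLifts {ι : Type*} (r C : ℝ) (h : ℂ → ι → ℂ → ℂ) : Prop where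
  pos : 0 < r
  diff : ∀ c i, DifferentiableOn ℂ (h c i) (ball c r)
  bound : ∀ c i, ∀ z ∈ ball c r, ‖h c i z‖ ≤ C
  compat : ∀ c, ∃ i, (∀ z ∈ ball c r, h c i z = 1) ∧
    ∀ c', ∀ z ∈ ball c r, z ∈ ball c' r → h c' i z ≠ 0 ∧ ∀ j, h c' j z = h c' i z * h c j z

theorem wronsk_div {f g k : ℂ → ℂ} {z : ℂ} (hf : DifferentiableAt ℂ f z)
    (hg : DifferentiableAt ℂ g z) (hk : DifferentiableAt ℂ k z) (h0 : k z ≠ 0) :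
    wronsk (fun w => f w / k w) (fun w => g w / k w) z = wronsk f g z / k z ^ 2 := by
  unfold wronsk
  rw [deriv_fun_div hf hk h0, deriv_fun_div hg hk h0]
  field_simp
  ring

/-- Brody's reparametrization lemma for holomorphic curves in projective space. -/
theorem exists_boundedLifts {ι : Type*} [Fintype ι] {f : ι → ℂ → ℂ}
    (hf : ∀ i, Differentiable ℂ (f i)) (hf0 : ∀ z, ∃ i, f i z ≠ 0)
    {a : ℂ} {i₀ j₀ : ι} (ha : wronsk (f i₀) (f j₀) a ≠ 0) :
    ∃ (r C : ℝ) (h : ℂ → ι → ℂ → ℂ), BoundedLifts r C h ∧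
      (∃ i j, wronsk (h 0 i) (h 0 j) 0 ≠ 0) ∧
      ∀ Z : Set (ι → ℂ), IsClosed Z → (∀ (t : ℂ), ∀ v ∈ Z, t • v ∈ Z) →
        (∀ z, (fun i => f i z) ∈ Z) → ∀ c, ∀ z ∈ ball c r, (fun i => h c i z) ∈ Z := by
  classical
  have : Nonempty ι := ⟨i₀⟩
  set q : ℝ := (Fintype.card ι : ℝ) with hq
  have hq1 : 1 ≤ q := by
    have : 1 ≤ Fintype.card ι := Fintype.card_pos
    rw [hq]; exact_mod_cast this
  set S : ℂ → ℝ := fun z => ∑ j, ‖f j z‖ ^ 2 with hS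
  set ρ : ℂ → ℝ := fun z => (∑ i, ∑ j, ‖wronsk (f i) (f j) z‖) / S z with hρdef
  have hSpos : ∀ z, 0 < S z := by
    intro z
    obtain ⟨k, hk⟩ := hf0 z
    exact Finset.sum_pos' (fun _ _ => by positivity) ⟨k, Finset.mem_univ _, by positivity⟩
  have hfc : ∀ i, Continuous (f i) := fun i => (hf i).continuous
  have hdc : ∀ i, Continuous (deriv (f i)) := fun i =>
    ((hf i).contDiff (n := 1)).continuous_deriv le_rfl
  have hρc : Continuous ρ := by
    refine Continuous.div ?_ ?_ fun z => (hSpos z).ne'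
    · unfold wronsk; fun_prop
    · fun_prop
  have hρa : 0 < ρ a := by
    refine div_pos (Finset.sum_pos' (fun _ _ => by positivity) ⟨i₀, Finset.mem_univ _, ?_⟩)
      (hSpos a)
    exact Finset.sum_pos' (fun _ _ => by positivity) ⟨j₀, Finset.mem_univ _, by positivity⟩
  choose b hb0 hb using fun n : ℕ => exists_rescaling_center hρc hρa (n : ℝ)
  set g : ℕ → ι → ℂ → ℂ := fun n i ζ => f i (b n + ζ / ρ (b n)) with hg
  have hgd : ∀ n i, Differentiable ℂ (g n i) := fun n i => by
    have := hf i
    fun_prop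
  have hg0 : ∀ n z, ∃ i, g n i z ≠ 0 := fun n z => hf0 _
  set T : ℕ → ℂ → ℝ := fun n z => ∑ j, ‖g n j z‖ ^ 2 with hT
  have hTpos : ∀ n z, 0 < T n z := fun n z => hSpos _
  have hgderiv : ∀ n i z, deriv (g n i) z = deriv (f i) (b n + z / ρ (b n)) / ρ (b n) := by
    intro n i z
    have h1 : HasDerivAt (fun ζ : ℂ => b n + ζ / ρ (b n)) (1 / ρ (b n) : ℂ) z :=
      ((hasDerivAt_id z).div_const _).const_add _
    have := ((hf i (b n + z / ρ (b n))).hasDerivAt).comp z h1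
    rw [mul_one_div] at this
    exact this.deriv
  have hgw : ∀ n z, ∑ i, ∑ j, ‖wronsk (g n i) (g n j) z‖ =
      ρ (b n + z / ρ (b n)) / ρ (b n) * T n z := by
    intro n z
    have h1 : ∀ i j, ‖wronsk (g n i) (g n j) z‖ =
        ‖wronsk (f i) (f j) (b n + z / ρ (b n))‖ / ρ (b n) := by
      intro i j
      have : wronsk (g n i) (g n j) z = wronsk (f i) (f j) (b n + z / ρ (b n)) / ρ (b n) := by
        unfold wronsk
        rw [hgderiv, hgderiv]
        simp only [hg]
        ring
      rw [this, norm_div, Complex.norm_real, Real.norm_eq_abs, abs_of_pos (hb0 n)]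
    simp only [h1, ← Finset.sum_div]
    have h2 : T n z = S (b n + z / ρ (b n)) := rfl
    have h3 : ∑ i, ∑ j, ‖wronsk (f i) (f j) (b n + z / ρ (b n))‖ =
        ρ (b n + z / ρ (b n)) * S (b n + z / ρ (b n)) :=
      (div_mul_cancel₀ _ (hSpos (b n + z / ρ (b n))).ne').symm
    rw [h2, h3]
    ring
  have hgw2 : ∀ (n : ℕ) z, ‖z‖ ≤ n → ∑ i, ∑ j, ‖wronsk (g n i) (g n j) z‖ ≤ 2 * T n z := by
    intro n z hz
    rw [hgw]
    have := (hTpos n z).le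
    gcongr
    rw [div_le_iff₀ (hb0 n)]
    exact hb n z hz
  set r : ℝ := 1 / (8 * q) with hr
  have hrpos : 0 < r := by positivity
  have hr1 : r ≤ 1 := by
    rw [hr, div_le_one (by positivity)]; linarith
  set C : ℝ := 2 * q with hC
  set U : Ultrafilter ℕ := Filter.hyperfilter ℕ with hU
  have hUN : ∀ N : ℝ, ∀ᶠ n : ℕ in U, N ≤ n := by
    intro N
    have h1 : ∀ᶠ n : ℕ in atTop, N ≤ n := tendsto_natCast_atTop_atTop.eventually_ge_atTop N
    rw [← Nat.cofinite_eq_atTop] at h1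
    exact Filter.hyperfilter_le_cofinite h1
  have hk : ∀ c, ∃ k, ∀ᶠ n : ℕ in U, ‖c‖ + 1 ≤ n ∧ 1 / q ≤ ‖g n k c‖ ^ 2 / T n c := by
    intro c
    rw [← Ultrafilter.eventually_exists_iff]
    filter_upwards [hUN (‖c‖ + 1)] with n hn
    have : ∃ k ∈ Finset.univ, T n c / q ≤ ‖g n k c‖ ^ 2 := by
      refine Finset.exists_le_of_sum_le Finset.univ_nonempty ?_
      rw [Finset.sum_const, Finset.card_univ, nsmul_eq_mul, ← hq]
      exact (mul_div_cancel₀ _ (by positivity)).le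
    obtain ⟨k, -, hk⟩ := this
    refine ⟨k, hn, ?_⟩
    rw [le_div_iff₀ (hTpos n c)]
    calc 1 / q * T n c = T n c / q := by ring
      _ ≤ _ := hk
  choose k hk using hk
  have hlow : ∀ c, ∀ᶠ n in U, ∀ z ∈ ball c r, T n z / (2 * q) ≤ ‖g n (k c) z‖ ^ 2 := by
    intro c
    filter_upwards [hk c] with n hn z hz
    have h1 := norm_sq_ratio_lower_bound (hgd n) (hg0 n) (c := c) (r := r) (fun w hw => by
      refine hgw2 n w ?_
      have h2 := norm_le_norm_add_norm_sub' w c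
      rw [mem_ball, dist_eq_norm] at hw
      rw [norm_sub_rev] at hw
      have := norm_sub_rev w c
      linarith [hn.1]) (k c) hz
    have h2 : 4 * dist z c ≤ 1 / (2 * q) := by
      have : dist z c ≤ 1 / (8 * q) := (mem_ball.1 hz).le
      calc 4 * dist z c ≤ 4 * (1 / (8 * q)) := by gcongr
        _ = 1 / (2 * q) := by field_simp; norm_num
    have h3 : 1 / q = 1 / (2 * q) + 1 / (2 * q) := by field_simp; norm_num
    have h4 : 1 / (2 * q) ≤ ‖g n (k c) z‖ ^ 2 / T n z := by
      have h5 : (1 : ℝ) / q - 4 * dist z c ≤ ‖g n (k c) z‖ ^ 2 / T n z :=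
        le_trans (by linarith [hn.2]) h1
      linarith
    rw [le_div_iff₀ (hTpos n z)] at h4
    calc T n z / (2 * q) = 1 / (2 * q) * T n z := by ring
      _ ≤ _ := h4
  have hne : ∀ c, ∀ᶠ n in U, ∀ z ∈ ball c r, g n (k c) z ≠ 0 := by
    intro c
    filter_upwards [hlow c] with n hn z hz h0
    have h1 := hn z hz
    have : 0 < T n z / (2 * q) := div_pos (hTpos n z) (by positivity)
    rw [h0] at h1
    simp at h1
    linarith
  have hbd : ∀ c j, ∀ᶠ n in U, ∀ z ∈ ball c r, ‖g n j z / g n (k c) z‖ ≤ C := by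
    intro c j
    filter_upwards [hlow c, hne c] with n hn hn0 z hz
    have h1 := hn z hz
    have h2 : ‖g n j z‖ ^ 2 ≤ T n z :=
      Finset.single_le_sum (f := fun j => ‖g n j z‖ ^ 2) (fun _ _ => by positivity)
        (Finset.mem_univ j)
    rw [norm_div, div_le_iff₀ (norm_pos_iff.2 (hn0 z hz))]
    rw [div_le_iff₀ (by positivity)] at h1
    refine le_of_sq_le_sq ?_ (by positivity)
    nlinarith [sq_nonneg ‖g n (k c) z‖]
  have hlim : ∀ c j z, ∃ l, z ∈ ball c r →
      Tendsto (fun n => g n j z / g n (k c) z) U (𝓝 l) := by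
    intro c j z
    by_cases hz : z ∈ ball c r
    · have h1 : ∀ᶠ n in U, g n j z / g n (k c) z ∈ closedBall (0 : ℂ) C := by
        filter_upwards [hbd c j] with n hn
        simpa using hn z hz
      obtain ⟨l, -, hl⟩ := (isCompact_closedBall (0 : ℂ) C).ultrafilter_le_nhds
        (U.map fun n => g n j z / g n (k c) z) (le_principal_iff.2 h1)
      exact ⟨l, fun _ => hl⟩
    · exact ⟨0, fun h => absurd h hz⟩
  choose h hh using hlim
  have hgdiff : ∀ c j, ∀ᶠ n in (U : Filter ℕ),
      DifferentiableOn ℂ (fun z => g n j z / g n (k c) z) (ball c r) := by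
    intro c j
    filter_upwards [hne c] with n hn
    exact (hgd n j).differentiableOn.div (hgd n _).differentiableOn hn
  have hloc : ∀ c j, TendstoLocallyUniformlyOn (fun n z => g n j z / g n (k c) z) (h c j)
      (U : Filter ℕ) (ball c r) := fun c j =>
    tendstoLocallyUniformlyOn_of_bounded isOpen_ball (hgdiff c j) (hbd c j)
      fun z hz => hh c j z hz
  have hderiv : ∀ c j, ∀ z ∈ ball c r, Tendsto
      (fun n => deriv (fun z => g n j z / g n (k c) z) z) U (𝓝 (deriv (h c j) z)) :=
    fun c j z hz => ((hloc c j).deriv (hgdiff c j) isOpen_ball).tendsto_at hz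
  have hone : ∀ c, ∀ z ∈ ball c r, h c (k c) z = 1 := by
    intro c z hz
    refine tendsto_nhds_unique (hh c (k c) z hz) (tendsto_const_nhds.congr' ?_)
    filter_upwards [hne c] with n hn
    rw [div_self (hn z hz)]
  have hmul : ∀ c c' j, ∀ z ∈ ball c r, z ∈ ball c' r →
      h c' j z = h c' (k c) z * h c j z := by
    intro c c' j z hz hz'
    refine tendsto_nhds_unique (hh c' j z hz') (((hh c' (k c) z hz').mul (hh c j z hz)).congr' ?_)
    filter_upwards [hne c, hne c'] with n hn hn'
    have := hn z hz
    have := hn' z hz'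
    field_simp
  refine ⟨r, C, h, ⟨hrpos, fun c i => (hloc c i).differentiableOn (hgdiff c i) isOpen_ball,
    fun c i z hz => ?_, fun c => ⟨k c, hone c, fun c' z hz hz' => ⟨?_, fun j =>
      hmul c c' j z hz hz'⟩⟩⟩, ?_, ?_⟩
  · refine le_of_tendsto (hh c i z hz).norm ?_
    filter_upwards [hbd c i] with n hn using hn z hz
  · intro h0
    have h1 := hmul c c' (k c') z hz hz'
    rw [hone c' z hz', h0, zero_mul] at h1
    exact one_ne_zero h1
  · by_contra! hcon
    have h0 : (0 : ℂ) ∈ ball (0 : ℂ) r := mem_ball_self hrpos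
    have h1 : Tendsto (fun n => ∑ i, ∑ j, ‖wronsk (fun z => g n i z / g n (k 0) z)
        (fun z => g n j z / g n (k 0) z) 0‖) U (𝓝 (∑ i, ∑ j, ‖wronsk (h 0 i) (h 0 j) 0‖)) := by
      refine tendsto_finsetSum _ fun i _ => tendsto_finsetSum _ fun j _ => Tendsto.norm ?_
      exact ((hh 0 i 0 h0).mul (hderiv 0 j 0 h0)).sub ((hderiv 0 i 0 h0).mul (hh 0 j 0 h0))
    simp only [hcon, norm_zero, Finset.sum_const_zero] at h1
    have h2 : (1 : ℝ) ≤ 0 := by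
      refine ge_of_tendsto h1 ?_
      filter_upwards [hne 0] with n hn
      have hn0 := hn 0 h0
      have h3 : ∀ i j, ‖wronsk (fun z => g n i z / g n (k 0) z)
          (fun z => g n j z / g n (k 0) z) 0‖ = ‖wronsk (g n i) (g n j) 0‖ / ‖g n (k 0) 0‖ ^ 2 := by
        intro i j
        rw [wronsk_div (hgd n i 0) (hgd n j 0) (hgd n _ 0) hn0, norm_div, norm_pow]
      simp only [h3, ← Finset.sum_div]
      rw [hgw, zero_div, add_zero, div_self (hb0 n).ne', one_mul, le_div_iff₀ (by positivity),
        one_mul]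
      exact Finset.single_le_sum (f := fun j => ‖g n j 0‖ ^ 2) (fun _ _ => by positivity)
        (Finset.mem_univ (k 0))
    linarith
  · intro Z hZ hZs hfZ c z hz
    refine hZ.mem_of_tendsto (tendsto_pi_nhds.2 fun j => hh c j z hz) ?_
    refine Eventually.of_forall fun n => ?_
    have := hZs (g n (k c) z)⁻¹ _ (hfZ (b n + z / ρ (b n)))
    convert this using 1
    ext j
    simp only [Pi.smul_apply, smul_eq_mul, hg]
    rw [div_eq_inv_mul]

theorem exists_jet_transition {r C : ℝ} {ι : Type*} {h : ℂ → ι → ℂ → ℂ}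
    (H : BoundedLifts r C h) {c c' z : ℂ} (hz : z ∈ ball c r) (hz' : z ∈ ball c' r) :
    ∃ t l m : ℂ, t ≠ 0 ∧ (∀ i, h c' i z = t * h c i z) ∧
      (∀ i, deriv (h c' i) z = t * deriv (h c i) z + l * h c i z) ∧
      ∀ i, deriv (deriv (h c' i)) z =
        t * deriv (deriv (h c i)) z + 2 * l * deriv (h c i) z + m * h c i z := by
  obtain ⟨i, hi, hcomp⟩ := H.compat c
  set u := h c' i
  have hU : IsOpen (ball c r ∩ ball c' r) := isOpen_ball.inter isOpen_ball
  have hzU : z ∈ ball c r ∩ ball c' r := ⟨hz, hz'⟩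
  have d1 : ∀ j, ∀ w ∈ ball c r ∩ ball c' r, DifferentiableAt ℂ (h c j) w := fun j w hw =>
    (H.diff c j).differentiableAt (isOpen_ball.mem_nhds hw.1)
  have d1' : ∀ j, ∀ w ∈ ball c r ∩ ball c' r, DifferentiableAt ℂ (h c' j) w := fun j w hw =>
    (H.diff c' j).differentiableAt (isOpen_ball.mem_nhds hw.2)
  have e1 : ∀ j, ∀ w ∈ ball c r ∩ ball c' r,
      deriv (h c' j) w = u w * deriv (h c j) w + deriv u w * h c j w := by
    intro j w hw
    have : h c' j =ᶠ[𝓝 w] fun x => u x * h c j x := by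
      filter_upwards [hU.mem_nhds hw] with x hx using (hcomp c' x hx.1 hx.2).2 j
    rw [this.deriv_eq, deriv_fun_mul (d1' i w hw) (d1 j w hw)]
    ring
  have d2 : ∀ j, DifferentiableAt ℂ (deriv (h c j)) z := fun j =>
    ((H.diff c j).deriv isOpen_ball).differentiableAt (isOpen_ball.mem_nhds hz)
  have d2' : DifferentiableAt ℂ (deriv u) z :=
    ((H.diff c' i).deriv isOpen_ball).differentiableAt (isOpen_ball.mem_nhds hz')
  refine ⟨u z, deriv u z, deriv (deriv u) z, (hcomp c' z hz hz').1, (hcomp c' z hz hz').2,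
    fun j => e1 j z hzU, fun j => ?_⟩
  have : deriv (h c' j) =ᶠ[𝓝 z] fun x => u x * deriv (h c j) x + deriv u x * h c j x := by
    filter_upwards [hU.mem_nhds hzU] with x hx using e1 j x hx
  rw [this.deriv_eq, deriv_fun_add ((d1' i z hzU).fun_mul (d2 j)) (d2'.fun_mul (d1 j z hzU)),
    deriv_fun_mul (d1' i z hzU) (d2 j), deriv_fun_mul d2' (d1 j z hzU)]
  ring

theorem BoundedLifts.deriv_bound {r C : ℝ} {ι : Type*} {h : ℂ → ι → ℂ → ℂ}
    (H : BoundedLifts r C h) (c : ℂ) (i : ι) :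
    ‖deriv (h c i) c‖ ≤ C / (r / 2) ∧ ‖deriv (deriv (h c i)) c‖ ≤ 2 * C / (r / 2) ^ 2 := by
  have hr := H.pos
  have hsub : closure (ball c (r / 2)) ⊆ ball c r :=
    closure_ball_subset_closedBall.trans (closedBall_subset_ball (by linarith))
  have hd : DiffContOnCl ℂ (h c i) (ball c (r / 2)) := ((H.diff c i).mono hsub).diffContOnCl
  have hb : ∀ z ∈ sphere c (r / 2), ‖h c i z‖ ≤ C := fun z hz =>
    H.bound c i z (sphere_subset_ball (by linarith) hz)
  refine ⟨Complex.norm_deriv_le_of_forall_mem_sphere_norm_le (by linarith) hd hb, ?_⟩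
  have := Complex.norm_iteratedDeriv_le_of_forall_mem_sphere_norm_le 2 (by linarith) hd hb
  rw [iteratedDeriv_succ, iteratedDeriv_one] at this
  simpa [Nat.factorial] using this

/-- A Liouville theorem for meromorphic functions given by quotients of differential polynomials
in the bounded local lifts, when the denominators have no common zero. -/
theorem BoundedLifts.exists_const_of_ratio {r C : ℝ} {ι κ : Type*} [Fintype ι] [Fintype κ]
    {h : ℂ → ι → ℂ → ℂ} (H : BoundedLifts r C h) {Y : Set (ι → ℂ)} (hYc : IsClosed Y)
    (hY : ∀ c, ∀ z ∈ ball c r, (fun i => h c i z) ∈ Y)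
    {Num : κ → (ι → ℂ) → (ι → ℂ) → (ι → ℂ) → ℂ} {Den : κ → (ι → ℂ) → ℂ}
    (hNd : ∀ k, Differentiable ℂ fun x : (ι → ℂ) × (ι → ℂ) × (ι → ℂ) => Num k x.1 x.2.1 x.2.2)
    (hDd : ∀ k, Differentiable ℂ (Den k)) (β : κ → ℕ)
    (hN : ∀ k t l m v p q, t ≠ 0 → Num k (fun i => t * v i) (fun i => t * p i + l * v i)
      (fun i => t * q i + 2 * l * p i + m * v i) = t ^ β k * Num k v p q)
    (hD : ∀ k t v, Den k (fun i => t * v i) = t ^ β k * Den k v)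
    (hrel : ∀ c, ∀ z ∈ ball c r, ∀ k k', Num k (fun i => h c i z) (fun i => deriv (h c i) z)
      (fun i => deriv (deriv (h c i)) z) * Den k' (fun i => h c i z) =
      Num k' (fun i => h c i z) (fun i => deriv (h c i) z)
      (fun i => deriv (deriv (h c i)) z) * Den k (fun i => h c i z))
    (hD0 : ∀ v ∈ Y, v ≠ 0 → ∃ k, Den k v ≠ 0) :
    ∃ K : ℂ, ∀ c, ∀ z ∈ ball c r, ∀ k, Num k (fun i => h c i z) (fun i => deriv (h c i) z)
      (fun i => deriv (deriv (h c i)) z) = K * Den k (fun i => h c i z) := by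
  have hne : ∀ c, ∀ z ∈ ball c r, (fun i => h c i z) ≠ 0 := by
    intro c z hz h0
    obtain ⟨i, hi, -⟩ := H.compat c
    have := congrFun h0 i
    simp [hi z hz] at this
  set P : κ → ℂ → ℂ → ℂ := fun k c z => Num k (fun i => h c i z) (fun i => deriv (h c i) z)
      (fun i => deriv (deriv (h c i)) z) with hP
  set E : κ → ℂ → ℂ → ℂ := fun k c z => Den k (fun i => h c i z) with hE
  have hR : ∀ c z, ∃ R : ℂ, z ∈ ball c r → ∀ k, P k c z = R * E k c z := by
    intro c z
    by_cases hz : z ∈ ball c r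
    · obtain ⟨k, hk⟩ := hD0 _ (hY c z hz) (hne c z hz)
      refine ⟨P k c z / E k c z, fun _ k' => ?_⟩
      rw [div_mul_eq_mul_div, eq_div_iff hk]
      exact hrel c z hz k' k
    · exact ⟨0, fun h => absurd h hz⟩
  choose R hR using hR
  have htrans : ∀ c c' z, z ∈ ball c r → z ∈ ball c' r → R c z = R c' z := by
    intro c c' z hz hz'
    obtain ⟨t, l, m, ht, e0, e1, e2⟩ := exists_jet_transition H hz hz'
    obtain ⟨k, hk⟩ := hD0 _ (hY c z hz) (hne c z hz)
    have h1 : P k c' z = t ^ β k * P k c z := by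
      simp only [hP, e0, e1, e2]
      exact hN k t l m _ _ _ ht
    have h2 : E k c' z = t ^ β k * E k c z := by
      simp only [hE, e0, hD]
    have h3 := hR c' z hz' k
    rw [h1, h2, hR c z hz k] at h3
    have h4 : t ^ β k * E k c z ≠ 0 := mul_ne_zero (pow_ne_zero _ ht) hk
    refine mul_right_cancel₀ h4 ?_
    linear_combination h3
  set F : ℂ → ℂ := fun z => R z z with hF
  have hr := H.pos
  have hFd : Differentiable ℂ F := by
    intro z₀
    have hz₀ : z₀ ∈ ball z₀ r := mem_ball_self hr
    obtain ⟨k, hk⟩ := hD0 _ (hY z₀ z₀ hz₀) (hne z₀ z₀ hz₀)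
    have d0 : ∀ i, DifferentiableAt ℂ (h z₀ i) z₀ := fun i =>
      (H.diff z₀ i).differentiableAt (isOpen_ball.mem_nhds hz₀)
    have d1 : ∀ i, DifferentiableAt ℂ (deriv (h z₀ i)) z₀ := fun i =>
      ((H.diff z₀ i).deriv isOpen_ball).differentiableAt (isOpen_ball.mem_nhds hz₀)
    have d2 : ∀ i, DifferentiableAt ℂ (deriv (deriv (h z₀ i))) z₀ := fun i =>
      (((H.diff z₀ i).deriv isOpen_ball).deriv isOpen_ball).differentiableAt
        (isOpen_ball.mem_nhds hz₀)
    have hEd : DifferentiableAt ℂ (E k z₀) z₀ :=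
      DifferentiableAt.comp z₀ (hDd k _) (differentiableAt_pi.2 d0)
    have hPd : DifferentiableAt ℂ (P k z₀) z₀ :=
      DifferentiableAt.comp (f := fun z => ((fun i => h z₀ i z), (fun i => deriv (h z₀ i) z),
        (fun i => deriv (deriv (h z₀ i)) z))) z₀ (hNd k _) ((differentiableAt_pi.2 d0).prodMk
        ((differentiableAt_pi.2 d1).prodMk (differentiableAt_pi.2 d2)))
    refine (hPd.div hEd hk).congr_of_eventuallyEq ?_
    filter_upwards [isOpen_ball.mem_nhds hz₀, hEd.continuousAt.eventually_ne hk] with w hw hw0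
    rw [Pi.div_apply, eq_div_iff hw0, hR z₀ w hw k, htrans z₀ w w hw (mem_ball_self hr)]
  obtain ⟨M, hM⟩ : ∃ M, ∀ z, ‖F z‖ ≤ M := by
    set A : Set ((ι → ℂ) × (ι → ℂ) × (ι → ℂ)) :=
      (closedBall 0 C ∩ (Y ∩ {v | 1 ≤ ‖v‖})) ×ˢ
        (closedBall 0 (C / (r / 2)) ×ˢ closedBall 0 (2 * C / (r / 2) ^ 2)) with hA
    have hAc : IsCompact A := by
      refine IsCompact.prod ?_ ((isCompact_closedBall _ _).prod (isCompact_closedBall _ _))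
      exact (isCompact_closedBall _ _).inter_right
        (hYc.inter (isClosed_le continuous_const continuous_norm))
    have hpos : ∀ x ∈ A, 0 < ∑ k, ‖Den k x.1‖ := by
      intro x hx
      have h1 : x.1 ≠ 0 := by
        intro h0
        have : (1 : ℝ) ≤ ‖x.1‖ := hx.1.2.2
        rw [h0, norm_zero] at this
        linarith
      obtain ⟨k, hk⟩ := hD0 x.1 hx.1.2.1 h1
      exact Finset.sum_pos' (fun _ _ => by positivity) ⟨k, Finset.mem_univ _, by positivity⟩
    have hcont : ContinuousOn (fun x : (ι → ℂ) × (ι → ℂ) × (ι → ℂ) =>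
        (∑ k, ‖Num k x.1 x.2.1 x.2.2‖) / ∑ k, ‖Den k x.1‖) A := by
      refine ContinuousOn.div ?_ ?_ fun x hx => (hpos x hx).ne'
      · exact (continuous_finsetSum _ fun k _ => (hNd k).continuous.norm).continuousOn
      · exact (continuous_finsetSum _ fun k _ =>
          ((hDd k).continuous.comp continuous_fst).norm).continuousOn
    obtain ⟨M, hM⟩ := hAc.exists_bound_of_continuousOn hcont
    refine ⟨M, fun z => ?_⟩
    have hz : z ∈ ball z r := mem_ball_self hr
    have hC0 : 0 ≤ C := by
      obtain ⟨i, -⟩ := H.compat z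
      exact (norm_nonneg _).trans (H.bound z i z hz)
    have hx : ((fun i => h z i z), (fun i => deriv (h z i) z), fun i => deriv (deriv (h z i)) z)
        ∈ A := by
      refine ⟨⟨?_, hY z z hz, ?_⟩, ?_, ?_⟩
      · rw [mem_closedBall_zero_iff, pi_norm_le_iff_of_nonneg hC0]
        exact fun i => H.bound z i z hz
      · obtain ⟨i, hi, -⟩ := H.compat z
        have := norm_le_pi_norm (fun i => h z i z) i
        rwa [hi z hz, norm_one] at this
      · rw [mem_closedBall_zero_iff, pi_norm_le_iff_of_nonneg (by positivity)]
        exact fun i => (H.deriv_bound z i).1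
      · rw [mem_closedBall_zero_iff, pi_norm_le_iff_of_nonneg (by positivity)]
        exact fun i => (H.deriv_bound z i).2
    have h1 := (le_abs_self _).trans (hM _ hx)
    refine le_trans ?_ h1
    rw [le_div_iff₀ (hpos _ hx), Finset.mul_sum]
    refine Finset.sum_le_sum fun k _ => ?_
    rw [← norm_mul]
    exact (congrArg norm (hR z z hz k)).ge
  refine ⟨F 0, fun c z hz k => ?_⟩
  have h1 : F z = F 0 := hFd.apply_eq_apply_of_bounded
    (isBounded_iff_forall_norm_le.2 ⟨M, by rintro _ ⟨z, rfl⟩; exact hM z⟩) z 0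
  rw [← h1]
  change P k c z = R z z * E k c z
  rw [hR c z hz k, htrans c z z hz (mem_ball_self hr)]

/-- If the quotients `Num k / Den k` have negative degree, all numerators vanish along a
nonconstant curve. -/
theorem BoundedLifts.eq_zero_of_ratio {r C : ℝ} {ι κ : Type*} [Fintype ι] [Fintype κ]
    {h : ℂ → ι → ℂ → ℂ} (H : BoundedLifts r C h) {Y : Set (ι → ℂ)} (hYc : IsClosed Y)
    (hY : ∀ c, ∀ z ∈ ball c r, (fun i => h c i z) ∈ Y)
    (hnc : ∃ i j, wronsk (h 0 i) (h 0 j) 0 ≠ 0)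
    {Num : κ → (ι → ℂ) → (ι → ℂ) → (ι → ℂ) → ℂ} {Den : κ → (ι → ℂ) → ℂ}
    (hNd : ∀ k, Differentiable ℂ fun x : (ι → ℂ) × (ι → ℂ) × (ι → ℂ) => Num k x.1 x.2.1 x.2.2)
    (hDd : ∀ k, Differentiable ℂ (Den k)) (α : κ → ℕ) {N : ℕ} (hN0 : N ≠ 0)
    (hN : ∀ k t l m v p q, t ≠ 0 → Num k (fun i => t * v i) (fun i => t * p i + l * v i)
      (fun i => t * q i + 2 * l * p i + m * v i) = t ^ α k * Num k v p q)
    (hD : ∀ k t v, Den k (fun i => t * v i) = t ^ (α k + N) * Den k v)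
    (hrel : ∀ c, ∀ z ∈ ball c r, ∀ k k', Num k (fun i => h c i z) (fun i => deriv (h c i) z)
      (fun i => deriv (deriv (h c i)) z) * Den k' (fun i => h c i z) =
      Num k' (fun i => h c i z) (fun i => deriv (h c i) z)
      (fun i => deriv (deriv (h c i)) z) * Den k (fun i => h c i z))
    (hD0 : ∀ v ∈ Y, v ≠ 0 → ∃ k, Den k v ≠ 0) :
    ∀ c, ∀ z ∈ ball c r, ∀ k, Num k (fun i => h c i z) (fun i => deriv (h c i) z)
      (fun i => deriv (deriv (h c i)) z) = 0 := by
  have hK : ∀ l, ∃ K : ℂ, ∀ c, ∀ z ∈ ball c r, ∀ k, h c l z ^ N * Num k (fun i => h c i z)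
      (fun i => deriv (h c i) z) (fun i => deriv (deriv (h c i)) z) =
      K * Den k (fun i => h c i z) := by
    intro l
    refine H.exists_const_of_ratio hYc hY (Num := fun k v p q => v l ^ N * Num k v p q)
      (fun k => ?_) hDd (fun k => α k + N) (fun k t a m v p q ht => ?_) hD
      (fun c z hz k k' => ?_) hD0
    · exact Differentiable.mul (by fun_prop) (hNd k)
    · simp only [hN k t a m v p q ht]; ring
    · linear_combination h c l z ^ N * hrel c z hz k k'
  choose K hK using hK
  by_cases hK0 : ∀ l, K l = 0
  · intro c z hz k
    obtain ⟨i, hi, -⟩ := H.compat c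
    have := hK i c z hz k
    rwa [hi z hz, one_pow, one_mul, hK0, zero_mul] at this
  · exfalso
    push Not at hK0
    obtain ⟨l, hl⟩ := hK0
    have hr := H.pos
    have hden : ∀ z ∈ ball (0 : ℂ) r, ∃ k, Den k (fun i => h 0 i z) ≠ 0 := by
      intro z hz
      refine hD0 _ (hY 0 z hz) fun h0 => ?_
      obtain ⟨i, hi, -⟩ := H.compat 0
      have := congrFun h0 i
      simp [hi z hz] at this
    have hl0 : ∀ z ∈ ball (0 : ℂ) r, h 0 l z ≠ 0 := by
      intro z hz h0
      obtain ⟨k, hk⟩ := hden z hz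
      have := hK l 0 z hz k
      rw [h0, zero_pow hN0, zero_mul] at this
      exact mul_ne_zero hl hk this.symm
    have hpow : ∀ i, ∀ z ∈ ball (0 : ℂ) r, h 0 i z ^ N = K i / K l * h 0 l z ^ N := by
      intro i z hz
      obtain ⟨k, hk⟩ := hden z hz
      refine mul_right_cancel₀ (mul_ne_zero hl hk) ?_
      have h1 := hK l 0 z hz k
      have h2 := hK i 0 z hz k
      have h3 : K i / K l * K l = K i := div_mul_cancel₀ _ hl
      linear_combination -(h 0 i z ^ N) * h1 + h 0 l z ^ N * h2 -
        h 0 l z ^ N * Den k (fun i => h 0 i z) * h3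
    have h0 : (0 : ℂ) ∈ ball (0 : ℂ) r := mem_ball_self hr
    have hd : ∀ i, HasDerivAt (h 0 i) (deriv (h 0 i) 0) 0 := fun i =>
      ((H.diff 0 i).differentiableAt (isOpen_ball.mem_nhds h0)).hasDerivAt
    have hw : ∀ i, wronsk (h 0 l) (h 0 i) 0 = 0 := by
      intro i
      have e1 : (fun z => h 0 i z ^ N) =ᶠ[𝓝 0] fun z => K i / K l * h 0 l z ^ N := by
        filter_upwards [isOpen_ball.mem_nhds h0] with z hz using hpow i z hz
      have e2 := e1.deriv_eq
      rw [((hd i).fun_pow N).deriv, (((hd l).fun_pow N).const_mul _).deriv] at e2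
      have e3 := hpow i 0 h0
      obtain ⟨M, rfl⟩ := Nat.exists_eq_succ_of_ne_zero hN0
      simp only [Nat.succ_eq_add_one, Nat.add_sub_cancel] at e2
      have e4 : (((M + 1 : ℕ) : ℂ) * h 0 i 0 ^ M) * wronsk (h 0 l) (h 0 i) 0 = 0 := by
        unfold wronsk
        rw [Nat.succ_eq_add_one, pow_succ, pow_succ] at e3
        linear_combination h 0 l 0 * e2 - (((M + 1 : ℕ) : ℂ)) * deriv (h 0 l) 0 * e3
      rcases mul_eq_zero.1 e4 with h5 | h5
      · rcases mul_eq_zero.1 h5 with h6 | h6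
        · exact absurd h6 (Nat.cast_ne_zero.2 (Nat.succ_ne_zero M))
        · have hi0 : h 0 i 0 = 0 := by
            by_contra hne
            exact pow_ne_zero M hne h6
          have hKi : K i = 0 := by
            rw [hi0, zero_pow hN0] at e3
            have := mul_eq_zero.1 e3.symm
            simpa [hl, hl0 0 h0] using this
          have hz : h 0 i =ᶠ[𝓝 0] fun _ => 0 := by
            filter_upwards [isOpen_ball.mem_nhds h0] with z hz
            have := hpow i z hz
            rw [hKi, zero_div, zero_mul] at this
            exact pow_eq_zero_iff hN0 |>.1 this
          unfold wronsk
          rw [hz.deriv_eq, hi0, deriv_const]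
          ring
      · exact h5
    obtain ⟨i, j, hij⟩ := hnc
    refine hij (mul_left_cancel₀ (hl0 0 h0) ?_)
    have h1 := hw i
    have h2 := hw j
    unfold wronsk at *
    linear_combination h 0 i 0 * h2 - h 0 j 0 * h1

theorem BoundedLifts.analyticOnNhd {r C : ℝ} {ι : Type*} {h : ℂ → ι → ℂ → ℂ}
    (H : BoundedLifts r C h) (c : ℂ) (i : ι) : AnalyticOnNhd ℂ (h c i) (ball c r) :=
  (H.diff c i).analyticOnNhd isOpen_ball

/-- A homogeneous equation which holds on one disc holds on all discs. -/
theorem BoundedLifts.propagate {r C : ℝ} {ι : Type*} [Fintype ι] {h : ℂ → ι → ℂ → ℂ}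
    (H : BoundedLifts r C h) {Q : (ι → ℂ) → ℂ} (hQ : Differentiable ℂ Q) {D : ℕ}
    (hQh : ∀ t v, Q (fun i => t * v i) = t ^ D * Q v)
    (h0 : ∀ z ∈ ball (0 : ℂ) r, Q (fun i => h 0 i z) = 0) :
    ∀ c, ∀ z ∈ ball c r, Q (fun i => h c i z) = 0 := by
  set A : Set ℂ := {c | ∀ z ∈ ball c r, Q (fun i => h c i z) = 0} with hA
  have hstep : ∀ c ∈ A, ∀ c' ∈ ball c r, c' ∈ A := by
    intro c hc c' hc' z hz
    have han : AnalyticOnNhd ℂ (fun z => Q (fun i => h c' i z)) (ball c' r) := by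
      refine DifferentiableOn.analyticOnNhd ?_ isOpen_ball
      exact hQ.comp_differentiableOn (differentiableOn_pi.2 fun i => H.diff c' i)
    refine han.eqOn_zero_of_preconnected_of_eventuallyEq_zero
      (convex_ball c' r).isPreconnected (mem_ball_self H.pos) ?_ hz
    filter_upwards [isOpen_ball.mem_nhds hc', isOpen_ball.mem_nhds (mem_ball_self H.pos)]
      with w hw hw'
    obtain ⟨i, -, hi⟩ := H.compat c
    have : (fun j => h c' j w) = fun j => h c' i w * h c j w := funext (hi c' w hw hw').2
    rw [this, hQh, hc w hw, mul_zero, Pi.zero_apply]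
  have hclopen : IsClopen A := by
    constructor
    · refine isClosed_of_closure_subset fun c hc => ?_
      obtain ⟨c', hc', hd⟩ := Metric.mem_closure_iff.1 hc r H.pos
      exact hstep c' hc' c hd
    · refine Metric.isOpen_iff.2 fun c hc => ⟨r, H.pos, hstep c hc⟩
  have : A = univ := hclopen.eq_univ ⟨0, h0⟩
  intro c
  exact this.ge (mem_univ c)

theorem AnalyticOnNhd.wronsk {f g : ℂ → ℂ} {U : Set ℂ} (hf : AnalyticOnNhd ℂ f U)
    (hg : AnalyticOnNhd ℂ g U) : AnalyticOnNhd ℂ (wronsk f g) U :=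
  (hf.mul hg.deriv).sub (hf.deriv.mul hg)

theorem exists_linear_relation_of_wronsk {f g : ℂ → ℂ} {U : Set ℂ} (hU : IsOpen U)
    (hUp : IsPreconnected U) (hf : AnalyticOnNhd ℂ f U) (hg : AnalyticOnNhd ℂ g U)
    (hw : ∀ z ∈ U, wronsk f g z = 0) :
    ∃ α β : ℂ, (α ≠ 0 ∨ β ≠ 0) ∧ ∀ z ∈ U, α * f z + β * g z = 0 := by
  by_cases h : ∃ z₀ ∈ U, f z₀ ≠ 0
  · obtain ⟨z₀, hz₀, hfz⟩ := h
    refine ⟨g z₀ / f z₀, -1, Or.inr (by norm_num), ?_⟩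
    have hev : ∀ᶠ z in 𝓝 z₀, z ∈ U ∧ f z ≠ 0 :=
      Filter.Eventually.and (hU.mem_nhds hz₀) ((hf z₀ hz₀).continuousAt.eventually_ne hfz)
    obtain ⟨s, hs, hball⟩ := Metric.eventually_nhds_iff_ball.1 hev
    have hq : ∀ z ∈ ball z₀ s, g z / f z = g z₀ / f z₀ := by
      intro z hz
      have hd : ∀ w ∈ ball z₀ s, HasDerivAt (fun w => g w / f w) 0 w := by
        intro w hw'
        obtain ⟨hwU, hw0⟩ := hball w hw'
        have := (hg w hwU).differentiableAt.hasDerivAt.fun_div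
          (hf w hwU).differentiableAt.hasDerivAt hw0
        have h1 := hw w hwU
        unfold wronsk at h1
        have h2 : deriv g w * f w - g w * deriv f w = 0 := by linear_combination h1
        rwa [h2, zero_div] at this
      refine (convex_ball z₀ s).is_const_of_fderivWithin_eq_zero (𝕜 := ℂ)
        (f := fun w => g w / f w)
        (fun w hw' => (hd w hw').differentiableAt.differentiableWithinAt)
        (fun w hw' => ?_) hz (mem_ball_self hs)
      rw [fderivWithin_of_isOpen isOpen_ball hw', (hd w hw').hasFDerivAt.fderiv]
      ext
      simp
    have han : AnalyticOnNhd ℂ (fun z => g z₀ / f z₀ * f z + -1 * g z) U :=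
      (analyticOnNhd_const.mul hf).add (analyticOnNhd_const.mul hg)
    intro z hz
    refine han.eqOn_zero_of_preconnected_of_eventuallyEq_zero hUp hz₀ ?_ hz
    filter_upwards [ball_mem_nhds z₀ hs] with w hw'
    have h1 := hq w hw'
    rw [div_eq_iff (hball w hw').2] at h1
    rw [h1, Pi.zero_apply]
    ring
  · push Not at h
    exact ⟨1, 0, Or.inl one_ne_zero, fun z hz => by rw [h z hz]; ring⟩

theorem exists_linear_relation_of_wronsk_three {f g k : ℂ → ℂ} {U : Set ℂ} (hU : IsOpen U)
    (hUp : IsPreconnected U) (hf : AnalyticOnNhd ℂ f U) (hg : AnalyticOnNhd ℂ g U)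
    (hk : AnalyticOnNhd ℂ k U)
    (hw : ∀ z ∈ U, f z * (deriv g z * deriv (deriv k) z - deriv (deriv g) z * deriv k z) -
      g z * (deriv f z * deriv (deriv k) z - deriv (deriv f) z * deriv k z) +
      k z * (deriv f z * deriv (deriv g) z - deriv (deriv f) z * deriv g z) = 0) :
    ∃ α β γ : ℂ, (α ≠ 0 ∨ β ≠ 0 ∨ γ ≠ 0) ∧ ∀ z ∈ U, α * f z + β * g z + γ * k z = 0 := by
  have hd : ∀ {p q : ℂ → ℂ}, AnalyticOnNhd ℂ p U → AnalyticOnNhd ℂ q U → ∀ z ∈ U,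
      deriv (wronsk p q) z = p z * deriv (deriv q) z - deriv (deriv p) z * q z := by
    intro p q hp hq z hz
    have h1 := ((hp z hz).differentiableAt.hasDerivAt.fun_mul
      (hq.deriv z hz).differentiableAt.hasDerivAt).fun_sub
      ((hp.deriv z hz).differentiableAt.hasDerivAt.fun_mul
      (hq z hz).differentiableAt.hasDerivAt)
    have h2 : deriv (wronsk p q) z = _ := h1.deriv
    rw [h2]
    ring
  obtain ⟨α, β, hαβ, h1⟩ := exists_linear_relation_of_wronsk hU hUp (hf.wronsk hg)
    (hf.wronsk hk) (fun z hz => by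
      unfold wronsk
      rw [show deriv (fun z => f z * deriv k z - deriv f z * k z) z = _ from hd hf hk z hz,
        show deriv (fun z => f z * deriv g z - deriv f z * g z) z = _ from hd hf hg z hz]
      linear_combination f z * hw z hz)
  have hgk : AnalyticOnNhd ℂ (fun z => α * g z + β * k z) U :=
    (analyticOnNhd_const.mul hg).add (analyticOnNhd_const.mul hk)
  obtain ⟨γ, ε, hγε, h2⟩ := exists_linear_relation_of_wronsk hU hUp hf hgk (fun z hz => by
    have h3 := h1 z hz
    unfold wronsk at h3 ⊢
    rw [(((hg z hz).differentiableAt.hasDerivAt.const_mul α).fun_add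
      ((hk z hz).differentiableAt.hasDerivAt.const_mul β)).deriv]
    linear_combination h3)
  by_cases hε : ε = 0
  · refine ⟨γ, 0, 0, ?_, fun z hz => ?_⟩
    · left
      simpa [hε] using hγε
    · have := h2 z hz
      rw [hε] at this
      linear_combination this
  · refine ⟨γ, ε * α, ε * β, ?_, fun z hz => ?_⟩
    · right
      rcases hαβ with h | h
      · exact Or.inl (mul_ne_zero hε h)
      · exact Or.inr (mul_ne_zero hε h)
    · linear_combination h2 z hz

theorem wronsk_eq_zero_of_linear {f g : ℂ → ℂ} {U : Set ℂ} (hU : IsOpen U)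
    (hf : DifferentiableOn ℂ f U) (hg : DifferentiableOn ℂ g U) {α β : ℂ} (h : α ≠ 0 ∨ β ≠ 0)
    (hr : ∀ z ∈ U, α * f z + β * g z = 0) : ∀ z ∈ U, wronsk f g z = 0 := by
  intro z hz
  have h1 : (fun z => α * f z + β * g z) =ᶠ[𝓝 z] fun _ => 0 := by
    filter_upwards [hU.mem_nhds hz] with w hw using hr w hw
  have h2 := h1.deriv_eq
  rw [deriv_const, (((hf.differentiableAt (hU.mem_nhds hz)).hasDerivAt.const_mul α).fun_add
    ((hg.differentiableAt (hU.mem_nhds hz)).hasDerivAt.const_mul β)).deriv] at h2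
  have h3 := hr z hz
  unfold wronsk
  rcases h with h | h
  · refine mul_left_cancel₀ h ?_
    linear_combination deriv g z * h3 - g z * h2
  · refine mul_left_cancel₀ h ?_
    linear_combination f z * h2 - deriv f z * h3

theorem wronsk_eq_zero_of_pow {f g : ℂ → ℂ} {U : Set ℂ} (hU : IsOpen U)
    (hUp : IsPreconnected U) (hf : AnalyticOnNhd ℂ f U) (hg : AnalyticOnNhd ℂ g U)
    {n : ℕ} (hn : n ≠ 0) (h : ∀ z ∈ U, wronsk (fun z => f z ^ n) (fun z => g z ^ n) z = 0) :
    ∀ z ∈ U, wronsk f g z = 0 := by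
  obtain ⟨m, rfl⟩ := Nat.exists_eq_succ_of_ne_zero hn
  have h1 : ∀ z ∈ U, f z ^ m * g z ^ m * wronsk f g z = 0 := by
    intro z hz
    have h2 := h z hz
    unfold wronsk at h2 ⊢
    rw [((hf z hz).differentiableAt.hasDerivAt.fun_pow _).deriv,
      ((hg z hz).differentiableAt.hasDerivAt.fun_pow _).deriv] at h2
    simp only [Nat.succ_eq_add_one, Nat.add_sub_cancel] at h2
    refine mul_left_cancel₀ (Nat.cast_ne_zero.2 hn : ((m + 1 : ℕ) : ℂ) ≠ 0) ?_
    linear_combination h2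
  rcases AnalyticOnNhd.eq_zero_or_eq_zero_of_mul_eq_zero ((hf.pow m).mul (hg.pow m))
    (hf.wronsk hg) (fun z hz => by simpa using h1 z hz) hUp with h2 | h2
  · rcases AnalyticOnNhd.eq_zero_or_eq_zero_of_mul_eq_zero (hf.pow m) (hg.pow m)
      (fun z hz => by simpa using h2 z hz) hUp with h3 | h3
    · exact wronsk_eq_zero_of_linear hU hf.differentiableOn hg.differentiableOn
        (α := 1) (β := 0) (by simp) fun z hz => by
          have := eq_zero_of_pow_eq_zero (h3 z hz)
          simp [this]
    · exact wronsk_eq_zero_of_linear hU hf.differentiableOn hg.differentiableOn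
        (α := 0) (β := 1) (by simp) fun z hz => by
          have := eq_zero_of_pow_eq_zero (h3 z hz)
          simp [this]
  · exact h2

/-- The exponent of the coordinate `m` in the `m`-th term of the equation of the surface. -/
def expo (N : ℕ) (m : Fin 4) : ℕ := if m = 0 then N + 8 else N + 12

/-- The cofactor in the `m`-th term of the equation of the surface. -/
noncomputable def cofac (a b : ℂ) (m : Fin 4) (v : Fin 4 → ℂ) : ℂ :=
  if m = 0 then v 0 ^ 4 + a * v 1 ^ 4 + b * v 2 ^ 4 else 1

/-- The first derivative of `cofac` along a jet. -/
noncomputable def cofacDeriv (a b : ℂ) (m : Fin 4) (v p : Fin 4 → ℂ) : ℂ :=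
  if m = 0 then 4 * (v 0 ^ 3 * p 0 + a * v 1 ^ 3 * p 1 + b * v 2 ^ 3 * p 2) else 0

/-- The second derivative of `cofac` along a jet. -/
noncomputable def cofacDerivTwo (a b : ℂ) (m : Fin 4) (v p q : Fin 4 → ℂ) : ℂ :=
  if m = 0 then 12 * (v 0 ^ 2 * p 0 ^ 2 + a * v 1 ^ 2 * p 1 ^ 2 + b * v 2 ^ 2 * p 2 ^ 2) +
    4 * (v 0 ^ 3 * q 0 + a * v 1 ^ 3 * q 1 + b * v 2 ^ 3 * q 2) else 0

/-- The `m`-th term of the equation of the surface. -/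
noncomputable def term (N : ℕ) (a b : ℂ) (m : Fin 4) (v : Fin 4 → ℂ) : ℂ :=
  v m ^ expo N m * cofac a b m v

/-- The first derivative of `term` along a jet, divided by `v m ^ (expo N m - 1)`. -/
noncomputable def termDeriv (N : ℕ) (a b : ℂ) (m : Fin 4) (v p : Fin 4 → ℂ) : ℂ :=
  expo N m * p m * cofac a b m v + v m * cofacDeriv a b m v p

/-- The second derivative of `term` along a jet, divided by `v m ^ (expo N m - 2)`. -/
noncomputable def termDerivTwo (N : ℕ) (a b : ℂ) (m : Fin 4) (v p q : Fin 4 → ℂ) : ℂ :=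
  expo N m * (expo N m - 1) * p m ^ 2 * cofac a b m v +
    2 * expo N m * v m * p m * cofacDeriv a b m v p + expo N m * v m * q m * cofac a b m v +
    v m ^ 2 * cofacDerivTwo a b m v p q

theorem hasDerivAt_cofac (a b : ℂ) (m : Fin 4) {y : Fin 4 → ℂ → ℂ} {p : Fin 4 → ℂ} {z : ℂ}
    (hy : ∀ i, HasDerivAt (y i) (p i) z) :
    HasDerivAt (fun w => cofac a b m fun i => y i w) (cofacDeriv a b m (fun i => y i z) p) z := by
  unfold cofac cofacDeriv
  split_ifs
  · refine ((((hy 0).fun_pow 4).fun_add (((hy 1).fun_pow 4).const_mul a)).fun_add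
      (((hy 2).fun_pow 4).const_mul b)).congr_deriv ?_
    push_cast
    ring
  · exact hasDerivAt_const _ _

theorem hasDerivAt_cofacDeriv (a b : ℂ) (m : Fin 4) {y y' : Fin 4 → ℂ → ℂ} {q : Fin 4 → ℂ}
    {z : ℂ} (hy : ∀ i, HasDerivAt (y i) (y' i z) z) (hy' : ∀ i, HasDerivAt (y' i) (q i) z) :
    HasDerivAt (fun w => cofacDeriv a b m (fun i => y i w) fun i => y' i w)
      (cofacDerivTwo a b m (fun i => y i z) (fun i => y' i z) q) z := by
  unfold cofacDeriv cofacDerivTwo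
  split_ifs
  · refine ((((((hy 0).fun_pow 3).fun_mul (hy' 0)).fun_add
      ((((hy 1).fun_pow 3).const_mul a).fun_mul (hy' 1))).fun_add
      ((((hy 2).fun_pow 3).const_mul b).fun_mul (hy' 2))).const_mul 4).congr_deriv ?_
    push_cast
    ring
  · exact hasDerivAt_const _ _

theorem expo_eq (N : ℕ) (m : Fin 4) : ∃ e, expo N m = e + 2 := by
  unfold expo
  split_ifs
  · exact ⟨N + 6, rfl⟩
  · exact ⟨N + 10, rfl⟩

theorem hasDerivAt_term (N : ℕ) (a b : ℂ) (m : Fin 4) {y : Fin 4 → ℂ → ℂ} {p : Fin 4 → ℂ} {z : ℂ}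
    (hy : ∀ i, HasDerivAt (y i) (p i) z) :
    HasDerivAt (fun w => term N a b m fun i => y i w)
      (y m z ^ (expo N m - 1) * termDeriv N a b m (fun i => y i z) p) z := by
  unfold term termDeriv
  refine (((hy m).fun_pow (expo N m)).fun_mul (hasDerivAt_cofac a b m hy)).congr_deriv ?_
  obtain ⟨e, he⟩ := expo_eq N m
  rw [he]
  simp only [show e + 2 - 1 = e + 1 from rfl]
  push_cast
  ring

theorem hasDerivAt_deriv_term (N : ℕ) (a b : ℂ) (m : Fin 4) {y y' : Fin 4 → ℂ → ℂ}
    {q : Fin 4 → ℂ} {z : ℂ} (hy : ∀ i, HasDerivAt (y i) (y' i z) z)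
    (hy' : ∀ i, HasDerivAt (y' i) (q i) z) :
    HasDerivAt (fun w => y m w ^ (expo N m - 1) *
      termDeriv N a b m (fun i => y i w) fun i => y' i w)
      (y m z ^ (expo N m - 2) *
        termDerivTwo N a b m (fun i => y i z) (fun i => y' i z) q) z := by
  unfold termDeriv termDerivTwo
  refine (((hy m).fun_pow (expo N m - 1)).fun_mul ((((hy' m).const_mul _).fun_mul
    (hasDerivAt_cofac a b m hy)).fun_add
    ((hy m).fun_mul (hasDerivAt_cofacDeriv a b m hy hy')))).congr_deriv ?_
  obtain ⟨e, he⟩ := expo_eq N m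
  rw [he]
  simp only [Nat.add_sub_cancel, show e + 2 - 1 = e + 1 from rfl]
  push_cast
  ring

theorem deriv_term (N : ℕ) (a b : ℂ) (m : Fin 4) {y : Fin 4 → ℂ → ℂ} {U : Set ℂ} (hU : IsOpen U)
    (hy : ∀ i, DifferentiableOn ℂ (y i) U) {z : ℂ} (hz : z ∈ U) :
    deriv (fun w => term N a b m fun i => y i w) z =
      y m z ^ (expo N m - 1) * termDeriv N a b m (fun i => y i z) (fun i => deriv (y i) z) ∧
    deriv (deriv fun w => term N a b m fun i => y i w) z =
      y m z ^ (expo N m - 2) * termDerivTwo N a b m (fun i => y i z) (fun i => deriv (y i) z)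
        (fun i => deriv (deriv (y i)) z) := by
  have h1 : ∀ w ∈ U, ∀ i, HasDerivAt (y i) (deriv (y i) w) w := fun w hw i =>
    ((hy i).differentiableAt (hU.mem_nhds hw)).hasDerivAt
  refine ⟨(hasDerivAt_term N a b m (h1 z hz)).deriv, ?_⟩
  have h2 : (deriv fun w => term N a b m fun i => y i w) =ᶠ[𝓝 z] fun w =>
      y m w ^ (expo N m - 1) * termDeriv N a b m (fun i => y i w) (fun i => deriv (y i) w) := by
    filter_upwards [hU.mem_nhds hz] with w hw using (hasDerivAt_term N a b m (h1 w hw)).deriv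
  rw [h2.deriv_eq]
  exact (hasDerivAt_deriv_term N a b m (h1 z hz) fun i =>
    (((hy i).deriv hU).differentiableAt (hU.mem_nhds hz)).hasDerivAt).deriv

theorem differentiable_cofac (a b : ℂ) (m : Fin 4) : Differentiable ℂ (cofac a b m) := by
  unfold cofac
  split_ifs <;> fun_prop

theorem differentiable_cofacDeriv (a b : ℂ) (m : Fin 4) : Differentiable ℂ
    fun x : (Fin 4 → ℂ) × (Fin 4 → ℂ) × (Fin 4 → ℂ) => cofacDeriv a b m x.1 x.2.1 := by
  unfold cofacDeriv
  split_ifs <;> fun_prop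

theorem differentiable_cofacDerivTwo (a b : ℂ) (m : Fin 4) : Differentiable ℂ
    fun x : (Fin 4 → ℂ) × (Fin 4 → ℂ) × (Fin 4 → ℂ) => cofacDerivTwo a b m x.1 x.2.1 x.2.2 := by
  unfold cofacDerivTwo
  split_ifs <;> fun_prop

theorem differentiable_term (N : ℕ) (a b : ℂ) (m : Fin 4) : Differentiable ℂ (term N a b m) := by
  unfold term
  have := differentiable_cofac a b m
  fun_prop

theorem differentiable_termDeriv (N : ℕ) (a b : ℂ) (m : Fin 4) : Differentiable ℂ
    fun x : (Fin 4 → ℂ) × (Fin 4 → ℂ) × (Fin 4 → ℂ) => termDeriv N a b m x.1 x.2.1 := by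
  unfold termDeriv
  have h1 := differentiable_cofac a b m
  have h2 := differentiable_cofacDeriv a b m
  fun_prop

theorem differentiable_termDerivTwo (N : ℕ) (a b : ℂ) (m : Fin 4) : Differentiable ℂ
    fun x : (Fin 4 → ℂ) × (Fin 4 → ℂ) × (Fin 4 → ℂ) => termDerivTwo N a b m x.1 x.2.1 x.2.2 := by
  unfold termDerivTwo
  have h1 := differentiable_cofac a b m
  have h2 := differentiable_cofacDeriv a b m
  have h3 := differentiable_cofacDerivTwo a b m
  fun_prop

/-- The degree of `cofac` plus one. -/
def cofacDeg (m : Fin 4) : ℕ := if m = 0 then 5 else 1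

theorem cofac_smul (a b : ℂ) (m : Fin 4) (t : ℂ) (v : Fin 4 → ℂ) :
    t * cofac a b m (fun i => t * v i) = t ^ cofacDeg m * cofac a b m v := by
  unfold cofac cofacDeg
  split_ifs <;> ring

theorem term_smul (N : ℕ) (a b : ℂ) (m : Fin 4) (t : ℂ) (v : Fin 4 → ℂ) :
    term N a b m (fun i => t * v i) = t ^ (N + 12) * term N a b m v := by
  unfold term cofac expo
  split_ifs <;> ring

theorem termDeriv_transform (N : ℕ) (a b : ℂ) (m : Fin 4) (t l : ℂ) (v p : Fin 4 → ℂ) :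
    t * termDeriv N a b m (fun i => t * v i) (fun i => t * p i + l * v i) =
      t ^ cofacDeg m * (t * termDeriv N a b m v p + (N + 12) * l * (v m * cofac a b m v)) := by
  unfold termDeriv cofac cofacDeriv cofacDeg expo
  split_ifs with h
  · subst h; push_cast; ring
  · push_cast; ring

theorem termDerivTwo_transform (N : ℕ) (a b : ℂ) (m : Fin 4) (t l k : ℂ) (v p q : Fin 4 → ℂ) :
    t * termDerivTwo N a b m (fun i => t * v i) (fun i => t * p i + l * v i)
      (fun i => t * q i + 2 * l * p i + k * v i) =
      t ^ cofacDeg m * (t ^ 2 * termDerivTwo N a b m v p q +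
        2 * (N + 12) * l * t * (v m * termDeriv N a b m v p) +
        ((N + 12) * (N + 11) * l ^ 2 + (N + 12) * k * t) * (v m ^ 2 * cofac a b m v)) := by
  unfold termDerivTwo termDeriv cofac cofacDeriv cofacDerivTwo cofacDeg expo
  split_ifs with h
  · subst h; push_cast; ring
  · push_cast; ring

/-- The affine cone over the surface. -/
def surface (N : ℕ) (a b : ℂ) : Set (Fin 4 → ℂ) :=
  {v | term N a b 3 v = term N a b 0 v + term N a b 1 v + term N a b 2 v}

theorem isClosed_surface (N : ℕ) (a b : ℂ) : IsClosed (surface N a b) :=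
  isClosed_eq (differentiable_term N a b 3).continuous
    (((differentiable_term N a b 0).continuous.add (differentiable_term N a b 1).continuous).add
      (differentiable_term N a b 2).continuous)

theorem surface_smul {N : ℕ} {a b : ℂ} {v : Fin 4 → ℂ} (hv : v ∈ surface N a b) (t : ℂ) :
    t • v ∈ surface N a b := by
  have h (m : Fin 4) : term N a b m (t • v) = t ^ (N + 12) * term N a b m v := term_smul N a b m t v
  have : term N a b 3 v = term N a b 0 v + term N a b 1 v + term N a b 2 v := hv
  change term N a b 3 (t • v) = term N a b 0 (t • v) + term N a b 1 (t • v) + term N a b 2 (t • v)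
  rw [h, h, h, h, this]
  ring

theorem eq_zero_of_mem_surface {N : ℕ} {a b : ℂ} {v : Fin 4 → ℂ} (hv : v ∈ surface N a b)
    {i j k : Fin 4} (hij : i ≠ j) (hik : i ≠ k) (hjk : j ≠ k) (hi : v i = 0) (hj : v j = 0)
    (hk : v k = 0) : v = 0 := by
  obtain ⟨l, hl⟩ : ∃ l, ∀ m, m ≠ l → v m = 0 := by
    have : ∀ i j k : Fin 4, i ≠ j → i ≠ k → j ≠ k →
      ∃ l, ∀ m, m ≠ l → m = i ∨ m = j ∨ m = k := by decide
    obtain ⟨l, hl⟩ := this i j k hij hik hjk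
    refine ⟨l, fun m hm => ?_⟩
    rcases hl m hm with rfl | rfl | rfl <;> assumption
  have hv' : term N a b 3 v = term N a b 0 v + term N a b 1 v + term N a b 2 v := hv
  have : v l = 0 := by
    have h0 := hl 0
    have h1 := hl 1
    have h2 := hl 2
    have h3 := hl 3
    clear hl
    simp only [term, expo, cofac] at hv'
    fin_cases l
    · simpa [h1, h2, h3] using hv'
    · simpa [h0, h2, h3] using hv'.symm
    · simpa [h0, h1, h3] using hv'.symm
    · simpa [h0, h1, h2] using hv'
  ext m
  by_cases h : m = l
  · rw [h, this, Pi.zero_apply]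
  · exact hl m h

theorem expo_add_cofacDeg (N : ℕ) (m : Fin 4) : expo N m + cofacDeg m = N + 13 := by
  unfold expo cofacDeg
  split_ifs <;> omega

/-- Along a nonconstant curve on the surface, three terms satisfying a linear relation with nonzero
coefficients are proportional. -/
theorem wronsk_term_eq_zero_of_three {r C : ℝ} {h : ℂ → Fin 4 → ℂ → ℂ} (H : BoundedLifts r C h)
    {N : ℕ} {a b : ℂ} (hY : ∀ c, ∀ z ∈ ball c r, (fun i => h c i z) ∈ surface N a b)
    (hnc : ∃ i j, wronsk (h 0 i) (h 0 j) 0 ≠ 0) {e : Fin 3 → Fin 4} (he : Function.Injective e)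
    {γ : Fin 3 → ℂ} (hγ : ∀ n, γ n ≠ 0)
    (hrel : ∀ c, ∀ z ∈ ball c r, ∑ n, γ n * term N a b (e n) (fun i => h c i z) = 0) (n : Fin 3) :
    ∀ z ∈ ball (0 : ℂ) r, wronsk (fun z => term N a b (e n) fun i => h 0 i z)
      (fun z => term N a b (e (n + 1)) fun i => h 0 i z) z = 0 := by
  have h01 : e 0 ≠ e 1 := he.ne (by decide)
  have h02 : e 0 ≠ e 2 := he.ne (by decide)
  have h12 : e 1 ≠ e 2 := he.ne (by decide)
  set Δ : Fin 4 → Fin 4 → (Fin 4 → ℂ) → (Fin 4 → ℂ) → ℂ := fun x y v p =>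
    v x * cofac a b x v * termDeriv N a b y v p - termDeriv N a b x v p * (v y * cofac a b y v)
    with hΔ
  have hsum : cofacDeg (e 0) + cofacDeg (e 1) + cofacDeg (e 2) ≤ 7 := by
    have : ∀ i j k : Fin 4, i ≠ j → i ≠ k → j ≠ k →
      cofacDeg i + cofacDeg j + cofacDeg k ≤ 7 := by decide
    exact this _ _ _ h01 h02 h12
  have hdeg : ∀ n, expo N (e n) - 1 = cofacDeg (e (n + 1)) + cofacDeg (e (n + 2)) +
      (N + 12 - (cofacDeg (e 0) + cofacDeg (e 1) + cofacDeg (e 2))) := by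
    intro n
    have h0 := expo_add_cofacDeg N (e n)
    obtain ⟨f, hf⟩ := expo_eq N (e n)
    fin_cases n <;> simp at * <;> omega
  have key := H.eq_zero_of_ratio (κ := Fin 3) (isClosed_surface N a b) hY hnc
    (Num := fun n v p _ => γ (n + 1) * γ (n + 2) * Δ (e (n + 1)) (e (n + 2)) v p)
    (Den := fun n v => v (e n) ^ (expo N (e n) - 1))
    (fun n => ?_) (fun n => ?_) (fun n => cofacDeg (e (n + 1)) + cofacDeg (e (n + 2)))
    (N := N + 12 - (cofacDeg (e 0) + cofacDeg (e 1) + cofacDeg (e 2))) (by omega)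
    (fun n t l m v p q ht => ?_) (fun n t v => ?_) (fun c z hz => ?_) (fun v hv hv0 => ?_)
  · intro z hz
    have d : ∀ i, DifferentiableOn ℂ (h 0 i) (ball 0 r) := H.diff 0
    have h1 := key 0 z hz (n + 2)
    have h2 : n + 2 + 1 = n := by fin_cases n <;> rfl
    have h3 : n + 2 + 2 = n + 1 := by fin_cases n <;> rfl
    rw [h2, h3] at h1
    have h4 := (mul_eq_zero.1 h1).resolve_left (mul_ne_zero (hγ _) (hγ _))
    simp only [hΔ] at h4
    unfold wronsk
    rw [(deriv_term N a b _ isOpen_ball d hz).1, (deriv_term N a b _ isOpen_ball d hz).1]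
    obtain ⟨f, hf⟩ := expo_eq N (e n)
    obtain ⟨g, hg⟩ := expo_eq N (e (n + 1))
    simp only [term, hf, hg, show f + 2 - 1 = f + 1 from rfl, show g + 2 - 1 = g + 1 from rfl]
    linear_combination h 0 (e n) z ^ (f + 1) * h 0 (e (n + 1)) z ^ (g + 1) * h4
  · have h1 := fun m => differentiable_cofac a b m
    have h2 := fun m => differentiable_termDeriv N a b m
    simp only [hΔ]
    have h3 := h1 (e (n + 1))
    have h4 := h1 (e (n + 2))
    have h5 := h2 (e (n + 1))
    have h6 := h2 (e (n + 2))
    fun_prop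
  · fun_prop
  · refine mul_left_cancel₀ ht ?_
    have c1 := cofac_smul a b (e (n + 1)) t v
    have c2 := cofac_smul a b (e (n + 2)) t v
    have d1 := termDeriv_transform N a b (e (n + 1)) t l v p
    have d2 := termDeriv_transform N a b (e (n + 2)) t l v p
    simp only [hΔ]
    rw [pow_add]
    generalize cofac a b (e (n + 1)) (fun i => t * v i) = C1 at *
    generalize cofac a b (e (n + 2)) (fun i => t * v i) = C2 at *
    generalize termDeriv N a b (e (n + 1)) (fun i => t * v i) _ = D1 at *
    generalize termDeriv N a b (e (n + 2)) (fun i => t * v i) _ = D2 at *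
    calc _ = γ (n + 1) * γ (n + 2) * (v (e (n + 1)) * (t * C1) * (t * D2) -
          (t * D1) * (v (e (n + 2)) * (t * C2))) := by ring
      _ = _ := by rw [c1, c2, d1, d2]; ring
  · simp only
    rw [mul_pow, ← hdeg]
  · have d : ∀ i, DifferentiableOn ℂ (h c i) (ball c r) := H.diff c
    have E0 := hrel c z hz
    have E1 : ∑ n, γ n * deriv (fun w => term N a b (e n) (fun i => h c i w)) z = 0 := by
      have h1 : (fun w => ∑ n, γ n * term N a b (e n) (fun i => h c i w)) =ᶠ[𝓝 z] fun _ => 0 := by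
        filter_upwards [isOpen_ball.mem_nhds hz] with w hw using hrel c w hw
      have h2 := h1.deriv_eq
      rw [deriv_const] at h2
      rw [← h2]
      symm
      refine (HasDerivAt.fun_sum fun n _ => (HasDerivAt.const_mul (γ n) ?_)).deriv
      exact (hasDerivAt_term N a b (e n) fun i => ((d i).differentiableAt
        (isOpen_ball.mem_nhds hz)).hasDerivAt).differentiableAt.hasDerivAt
    simp only [(deriv_term N a b _ isOpen_ball d hz).1] at E1
    have E0' : ∑ n, γ n * (h c (e n) z ^ (expo N (e n) - 1) *
        (h c (e n) z * cofac a b (e n) (fun i => h c i z))) = 0 := by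
      rw [← E0]
      refine Finset.sum_congr rfl fun n _ => ?_
      obtain ⟨f, hf⟩ := expo_eq N (e n)
      rw [term, hf, show f + 2 - 1 = f + 1 from rfl]
      ring
    set w : Fin 3 → ℂ := fun n => h c (e n) z ^ (expo N (e n) - 1) with hw
    set x : Fin 3 → ℂ := fun n => h c (e n) z * cofac a b (e n) (fun i => h c i z) with hx
    set y : Fin 3 → ℂ := fun n =>
      termDeriv N a b (e n) (fun i => h c i z) (fun i => deriv (h c i) z) with hy
    have E0'' : γ 0 * (w 0 * x 0) + γ 1 * (w 1 * x 1) + γ 2 * (w 2 * x 2) = 0 := by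
      rw [← Fin.sum_univ_three fun n => γ n * (w n * x n)]
      exact E0'
    have E1' : γ 0 * (w 0 * y 0) + γ 1 * (w 1 * y 1) + γ 2 * (w 2 * y 2) = 0 := by
      rw [← Fin.sum_univ_three fun n => γ n * (w n * y n)]
      exact E1
    have P01 : γ 1 * γ 2 * (x 1 * y 2 - y 1 * x 2) * w 1 = γ 2 * γ 0 * (x 2 * y 0 - y 2 * x 0) * w 0 := by
      linear_combination γ 2 * (y 2 * E0'' - x 2 * E1')
    have P12 : γ 2 * γ 0 * (x 2 * y 0 - y 2 * x 0) * w 2 = γ 0 * γ 1 * (x 0 * y 1 - y 0 * x 1) * w 1 := by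
      linear_combination γ 0 * (y 0 * E0'' - x 0 * E1')
    have P20 : γ 0 * γ 1 * (x 0 * y 1 - y 0 * x 1) * w 0 = γ 1 * γ 2 * (x 1 * y 2 - y 1 * x 2) * w 2 := by
      linear_combination γ 1 * (y 1 * E0'' - x 1 * E1')
    intro k k'
    fin_cases k <;> fin_cases k'
    · rfl
    · exact P01
    · exact P20.symm
    · exact P01.symm
    · rfl
    · exact P12
    · exact P20
    · exact P12.symm
    · rfl
  · by_contra! hcon
    have : ∀ n, v (e n) = 0 := fun n => eq_zero_of_pow_eq_zero (hcon n)
    exact hv0 (eq_zero_of_mem_surface hv h01 h02 h12 (this 0) (this 1) (this 2))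

theorem BoundedLifts.analyticOnNhd_term {r C : ℝ} {h : ℂ → Fin 4 → ℂ → ℂ}
    (H : BoundedLifts r C h) (N : ℕ) (a b : ℂ) (m : Fin 4) :
    AnalyticOnNhd ℂ (fun z => term N a b m fun i => h 0 i z) (ball 0 r) := by
  refine DifferentiableOn.analyticOnNhd ?_ isOpen_ball
  exact (differentiable_term N a b m).comp_differentiableOn (differentiableOn_pi.2 (H.diff 0))

theorem BoundedLifts.propagate_term {r C : ℝ} {h : ℂ → Fin 4 → ℂ → ℂ}
    (H : BoundedLifts r C h) {N : ℕ} {a b : ℂ} {e : Fin 3 → Fin 4} {γ : Fin 3 → ℂ}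
    (h0 : ∀ z ∈ ball (0 : ℂ) r, ∑ n, γ n * term N a b (e n) (fun i => h 0 i z) = 0) :
    ∀ c, ∀ z ∈ ball c r, ∑ n, γ n * term N a b (e n) (fun i => h c i z) = 0 := by
  refine H.propagate (Q := fun v => ∑ n, γ n * term N a b (e n) v) ?_ (D := N + 12)
    (fun t v => ?_) h0
  · have := fun m => differentiable_term N a b m
    fun_prop
  · rw [Finset.mul_sum]
    refine Finset.sum_congr rfl fun n _ => ?_
    rw [term_smul]
    ring

theorem deriv_eq_add_three {f g₀ g₁ g₂ : ℂ → ℂ} {U : Set ℂ} (hU : IsOpen U)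
    (h₀ : DifferentiableOn ℂ g₀ U) (h₁ : DifferentiableOn ℂ g₁ U) (h₂ : DifferentiableOn ℂ g₂ U)
    (h : ∀ z ∈ U, f z = g₀ z + g₁ z + g₂ z) {z : ℂ} (hz : z ∈ U) :
    deriv f z = deriv g₀ z + deriv g₁ z + deriv g₂ z := by
  have h' : f =ᶠ[𝓝 z] fun z => g₀ z + g₁ z + g₂ z := by
    filter_upwards [hU.mem_nhds hz] with w hw using h w hw
  have hd : ∀ {g : ℂ → ℂ}, DifferentiableOn ℂ g U → HasDerivAt g (deriv g z) z := fun hg =>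
    (hg.differentiableAt (hU.mem_nhds hz)).hasDerivAt
  rw [h'.deriv_eq]
  exact (((hd h₀).fun_add (hd h₁)).fun_add (hd h₂)).deriv

/-- Along a nonconstant curve on the surface the first three terms are linearly dependent. -/
theorem exists_linear_relation_term {r C : ℝ} {h : ℂ → Fin 4 → ℂ → ℂ} (H : BoundedLifts r C h)
    {N : ℕ} (hN : N ≠ 0) {a b : ℂ} (hY : ∀ c, ∀ z ∈ ball c r, (fun i => h c i z) ∈ surface N a b)
    (hnc : ∃ i j, wronsk (h 0 i) (h 0 j) 0 ≠ 0) :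
    ∃ α β γ : ℂ, (α ≠ 0 ∨ β ≠ 0 ∨ γ ≠ 0) ∧ ∀ z ∈ ball (0 : ℂ) r,
      α * term N a b 0 (fun i => h 0 i z) + β * term N a b 1 (fun i => h 0 i z) +
      γ * term N a b 2 (fun i => h 0 i z) = 0 := by
  set u : Fin 4 → (Fin 4 → ℂ) → ℂ := fun m v => v m ^ 2 * cofac a b m v with hu
  set u' : Fin 4 → (Fin 4 → ℂ) → (Fin 4 → ℂ) → ℂ := fun m v p => v m * termDeriv N a b m v p
    with hu'
  set u'' := termDerivTwo N a b with hu''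
  set Δ : Fin 4 → Fin 4 → Fin 4 → (Fin 4 → ℂ) → (Fin 4 → ℂ) → (Fin 4 → ℂ) → ℂ :=
    fun x y w v p q => u x v * (u' y v p * u'' w v p q - u'' y v p q * u' w v p) -
      u y v * (u' x v p * u'' w v p q - u'' x v p q * u' w v p) +
      u w v * (u' x v p * u'' y v p q - u'' x v p q * u' y v p) with hΔ
  set s : Fin 4 → Fin 4 → Fin 4 := fun n m => if m = n then 3 else m with hs
  have hdeg : ∀ n, expo N n - 2 = cofacDeg (s n 0) + 1 + (cofacDeg (s n 1) + 1) +
      (cofacDeg (s n 2) + 1) + N := by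
    intro n
    fin_cases n <;> simp [hs, cofacDeg, expo] <;> omega
  have key := H.eq_zero_of_ratio (κ := Fin 4) (isClosed_surface N a b) hY hnc
    (Num := fun n v p q => Δ (s n 0) (s n 1) (s n 2) v p q)
    (Den := fun n v => v n ^ (expo N n - 2))
    (fun n => ?_) (fun n => ?_)
    (fun n => cofacDeg (s n 0) + 1 + (cofacDeg (s n 1) + 1) + (cofacDeg (s n 2) + 1))
    hN (fun n t l m v p q ht => ?_) (fun n t v => ?_) (fun c z hz => ?_) (fun v hv hv0 => ?_)
  · refine exists_linear_relation_of_wronsk_three isOpen_ball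
      (convex_ball (0 : ℂ) r).isPreconnected (H.analyticOnNhd_term N a b 0)
      (H.analyticOnNhd_term N a b 1) (H.analyticOnNhd_term N a b 2) fun z hz => ?_
    have d : ∀ i, DifferentiableOn ℂ (h 0 i) (ball 0 r) := H.diff 0
    have h1 := key 0 z hz 3
    have h2 : s 3 0 = 0 ∧ s 3 1 = 1 ∧ s 3 2 = 2 := by simp [hs]
    rw [h2.1, h2.2.1, h2.2.2] at h1
    simp only [hΔ, hu, hu', hu''] at h1
    rw [(deriv_term N a b 0 isOpen_ball d hz).1, (deriv_term N a b 1 isOpen_ball d hz).1,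
      (deriv_term N a b 2 isOpen_ball d hz).1, (deriv_term N a b 0 isOpen_ball d hz).2,
      (deriv_term N a b 1 isOpen_ball d hz).2, (deriv_term N a b 2 isOpen_ball d hz).2]
    obtain ⟨e, he⟩ := expo_eq N 0
    obtain ⟨f, hf⟩ := expo_eq N 1
    obtain ⟨g, hg⟩ := expo_eq N 2
    simp only [term, he, hf, hg, Nat.add_sub_cancel, show e + 2 - 1 = e + 1 from rfl,
      show f + 2 - 1 = f + 1 from rfl, show g + 2 - 1 = g + 1 from rfl]
    linear_combination h 0 0 z ^ e * h 0 1 z ^ f * h 0 2 z ^ g * h1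
  · have h1 := fun m => differentiable_cofac a b m
    have h2 := fun m => differentiable_termDeriv N a b m
    have h3 := fun m => differentiable_termDerivTwo N a b m
    have k1 : ∀ m, Differentiable ℂ fun x : (Fin 4 → ℂ) × (Fin 4 → ℂ) × (Fin 4 → ℂ) =>
        u m x.1 := by
      intro m
      have := h1 m
      simp only [hu]
      fun_prop
    have k2 : ∀ m, Differentiable ℂ fun x : (Fin 4 → ℂ) × (Fin 4 → ℂ) × (Fin 4 → ℂ) =>
        u' m x.1 x.2.1 := by
      intro m
      have := h2 m
      simp only [hu']
      fun_prop
    have k3 : ∀ m, Differentiable ℂ fun x : (Fin 4 → ℂ) × (Fin 4 → ℂ) × (Fin 4 → ℂ) =>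
        u'' m x.1 x.2.1 x.2.2 := h3
    simp only [hΔ]
    generalize s n 0 = x
    generalize s n 1 = y
    generalize s n 2 = w
    exact (((k1 x).mul (((k2 y).mul (k3 w)).sub ((k3 y).mul (k2 w)))).sub
      ((k1 y).mul (((k2 x).mul (k3 w)).sub ((k3 x).mul (k2 w))))).add
      ((k1 w).mul (((k2 x).mul (k3 y)).sub ((k3 x).mul (k2 y))))
  · fun_prop
  · generalize s n 0 = x
    generalize s n 1 = y
    generalize s n 2 = w
    have c0 : ∀ m, u m (fun i => t * v i) = t ^ cofacDeg m * (t * u m v) := by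
      intro m
      simp only [hu]
      linear_combination (t * v m ^ 2) * cofac_smul a b m t v
    have c1 : ∀ m, u' m (fun i => t * v i) (fun i => t * p i + l * v i) =
        t ^ cofacDeg m * (t * u' m v p + (N + 12) * l * u m v) := by
      intro m
      simp only [hu, hu']
      linear_combination v m * termDeriv_transform N a b m t l v p
    have c2 : ∀ k, t * u'' k (fun i => t * v i) (fun i => t * p i + l * v i)
        (fun i => t * q i + 2 * l * p i + m * v i) = t ^ cofacDeg k * (t ^ 2 * u'' k v p q +
        2 * (N + 12) * l * t * u' k v p +
        ((N + 12) * (N + 11) * l ^ 2 + (N + 12) * m * t) * u k v) := by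
      intro k
      simp only [hu, hu', hu'']
      exact termDerivTwo_transform N a b k t l m v p q
    refine mul_left_cancel₀ ht ?_
    have c2x := c2 x
    have c2y := c2 y
    have c2w := c2 w
    simp only [hΔ, c0, c1]
    generalize u'' x (fun i => t * v i) _ _ = X at *
    generalize u'' y (fun i => t * v i) _ _ = Y at *
    generalize u'' w (fun i => t * v i) _ _ = W at *
    clear c0 c1 c2
    clear_value u u' u''
    generalize u x v = x0 at *
    generalize u y v = y0 at *
    generalize u w v = w0 at *
    generalize u' x v p = x1 at *
    generalize u' y v p = y1 at *
    generalize u' w v p = w1 at *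
    generalize u'' x v p q = x2 at *
    generalize u'' y v p q = y2 at *
    generalize u'' w v p q = w2 at *
    have e0 : t ^ (cofacDeg x + 1 + (cofacDeg y + 1) + (cofacDeg w + 1)) =
      t ^ cofacDeg x * t ^ cofacDeg y * t ^ cofacDeg w * t ^ 3 := by ring
    rw [e0]
    generalize t ^ cofacDeg x = sx at *
    generalize t ^ cofacDeg y = sy at *
    generalize t ^ cofacDeg w = sw at *
    linear_combination
      (sy * (t * y0) * (sw * (t * w1 + (N + 12) * l * w0)) -
        sw * (t * w0) * (sy * (t * y1 + (N + 12) * l * y0))) * c2x +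
      (sw * (t * w0) * (sx * (t * x1 + (N + 12) * l * x0)) -
        sx * (t * x0) * (sw * (t * w1 + (N + 12) * l * w0))) * c2y +
      (sx * (t * x0) * (sy * (t * y1 + (N + 12) * l * y0)) -
        sy * (t * y0) * (sx * (t * x1 + (N + 12) * l * x0))) * c2w
  · simp only
    rw [mul_pow, ← hdeg]
  · have d : ∀ i, DifferentiableOn ℂ (h c i) (ball c r) := H.diff c
    have hv : ∀ w ∈ ball c r, term N a b 3 (fun i => h c i w) =
        term N a b 0 (fun i => h c i w) + term N a b 1 (fun i => h c i w) +
        term N a b 2 (fun i => h c i w) := hY c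
    have hT : ∀ m, DifferentiableOn ℂ (fun w => term N a b m fun i => h c i w) (ball c r) :=
      fun m => (differentiable_term N a b m).comp_differentiableOn (differentiableOn_pi.2 d)
    have hD : ∀ w ∈ ball c r, deriv (fun w => term N a b 3 (fun i => h c i w)) w =
        deriv (fun w => term N a b 0 (fun i => h c i w)) w +
        deriv (fun w => term N a b 1 (fun i => h c i w)) w +
        deriv (fun w => term N a b 2 (fun i => h c i w)) w :=
      fun w hw => deriv_eq_add_three isOpen_ball (hT 0) (hT 1) (hT 2) hv hw
    have hDD := deriv_eq_add_three isOpen_ball ((hT 0).deriv isOpen_ball)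
      ((hT 1).deriv isOpen_ball) ((hT 2).deriv isOpen_ball) hD hz
    have E0 := hv z hz
    have E1 := hD z hz
    simp only [(deriv_term N a b _ isOpen_ball d hz).1] at E1
    have E2 := hDD
    simp only [(deriv_term N a b _ isOpen_ball d hz).2] at E2
    set g : Fin 4 → ℂ := fun n => h c n z ^ (expo N n - 2) with hg
    set x : Fin 4 → ℂ := fun n => u n (fun i => h c i z) with hx
    set y : Fin 4 → ℂ := fun n => u' n (fun i => h c i z) (fun i => deriv (h c i) z) with hy
    set w : Fin 4 → ℂ := fun n => u'' n (fun i => h c i z) (fun i => deriv (h c i) z)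
      (fun i => deriv (deriv (h c i)) z) with hw
    have hterm0 : ∀ n, term N a b n (fun i => h c i z) = g n * x n := by
      intro n
      obtain ⟨f, hf⟩ := expo_eq N n
      simp only [term, hg, hx, hu, hf, Nat.add_sub_cancel]
      ring
    have hterm1 : ∀ n, h c n z ^ (expo N n - 1) *
        termDeriv N a b n (fun i => h c i z) (fun i => deriv (h c i) z) = g n * y n := by
      intro n
      obtain ⟨f, hf⟩ := expo_eq N n
      simp only [hg, hy, hu', hf, Nat.add_sub_cancel, show f + 2 - 1 = f + 1 from rfl]
      ring
    simp only [hterm0] at E0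
    simp only [hterm1] at E1
    replace E2 : g 3 * w 3 = g 0 * w 0 + g 1 * w 1 + g 2 * w 2 := E2
    set Δ' : Fin 4 → Fin 4 → Fin 4 → ℂ := fun i j k => x i * (y j * w k - w j * y k) -
      x j * (y i * w k - w i * y k) + x k * (y i * w j - w i * y j) with hΔ'
    have P01 : Δ' 3 1 2 * g 1 = Δ' 0 3 2 * g 0 := by
      simp only [hΔ']
      linear_combination (y 3 * w 2 - w 3 * y 2) * E0 - (x 3 * w 2 - x 2 * w 3) * E1 - (x 2 * y 3 - x 3 * y 2) * E2
    have P02 : Δ' 3 1 2 * g 2 = Δ' 0 1 3 * g 0 := by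
      simp only [hΔ']
      linear_combination -(y 3 * w 1 - w 3 * y 1) * E0 + (x 3 * w 1 - x 1 * w 3) * E1 + (x 1 * y 3 - x 3 * y 1) * E2
    have P12 : Δ' 0 3 2 * g 2 = Δ' 0 1 3 * g 1 := by
      simp only [hΔ']
      linear_combination (y 3 * w 0 - w 3 * y 0) * E0 - (x 3 * w 0 - x 0 * w 3) * E1 - (x 0 * y 3 - x 3 * y 0) * E2
    have P03 : Δ' 3 1 2 * g 3 = Δ' 0 1 2 * g 0 := by
      simp only [hΔ']
      linear_combination (y 1 * w 2 - w 1 * y 2) * E0 - (x 1 * w 2 - x 2 * w 1) * E1 - (x 2 * y 1 - x 1 * y 2) * E2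
    have P13 : Δ' 0 3 2 * g 3 = Δ' 0 1 2 * g 1 := by
      simp only [hΔ']
      linear_combination -(y 0 * w 2 - w 0 * y 2) * E0 + (x 0 * w 2 - x 2 * w 0) * E1 + (x 2 * y 0 - x 0 * y 2) * E2
    have P23 : Δ' 0 1 3 * g 3 = Δ' 0 1 2 * g 2 := by
      simp only [hΔ']
      linear_combination (y 0 * w 1 - w 0 * y 1) * E0 - (x 0 * w 1 - x 1 * w 0) * E1 - (x 1 * y 0 - x 0 * y 1) * E2
    have hP : ∀ k k', Δ' (s k 0) (s k 1) (s k 2) * g k' = Δ' (s k' 0) (s k' 1) (s k' 2) * g k := by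
      intro k k'
      fin_cases k <;> fin_cases k'
      · rfl
      · exact P01
      · exact P02
      · exact P03
      · exact P01.symm
      · rfl
      · exact P12
      · exact P13
      · exact P02.symm
      · exact P12.symm
      · rfl
      · exact P23
      · exact P03.symm
      · exact P13.symm
      · exact P23.symm
      · rfl
    exact hP
  · by_contra! hcon
    have : ∀ n, v n = 0 := fun n => eq_zero_of_pow_eq_zero (hcon n)
    exact hv0 (funext this)

theorem AnalyticOnNhd.eq_zero_or_eq_zero_on_ball {r : ℝ} {c : ℂ} {f g : ℂ → ℂ}
    (hf : AnalyticOnNhd ℂ f (ball c r)) (hg : AnalyticOnNhd ℂ g (ball c r))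
    (h : ∀ z ∈ ball c r, f z * g z = 0) :
    (∀ z ∈ ball c r, f z = 0) ∨ ∀ z ∈ ball c r, g z = 0 :=
  hf.eq_zero_or_eq_zero_of_mul_eq_zero hg h (convex_ball c r).isPreconnected

theorem wronsk_eq_zero_of_left {f g : ℂ → ℂ} {U : Set ℂ} (hU : IsOpen U)
    (hf : DifferentiableOn ℂ f U) (hg : DifferentiableOn ℂ g U) (h : ∀ z ∈ U, f z = 0) :
    ∀ z ∈ U, wronsk f g z = 0 :=
  wronsk_eq_zero_of_linear hU hf hg (α := 1) (β := 0) (Or.inl one_ne_zero)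
    fun z hz => by rw [h z hz]; ring

theorem wronsk_swap (f g : ℂ → ℂ) (z : ℂ) : wronsk f g z = -wronsk g f z := by
  unfold wronsk
  ring

theorem superelliptic_no_zero {N : ℕ} {α β σ x y z : ℂ} (hβ : ‖β‖ ≤ 1) (hσ : ‖σ‖ = 1) (hx : x = 0)
    (hrel : z ^ (N + 12) + β * z ^ (N + 8) * y ^ 4 + σ * y ^ (N + 12) +
      α * z ^ (N + 8) * x ^ 4 = 0)
    (hder : 4 * β * z ^ (N + 8) * y ^ 3 + σ * (N + 12) * y ^ (N + 11) = 0) : z = 0 ∧ y = 0 := by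
  have hσ0 : σ ≠ 0 := norm_ne_zero_iff.1 (by rw [hσ]; norm_num)
  have hN : ((N : ℂ) + 12) ≠ 0 := by exact_mod_cast (show N + 12 ≠ 0 by omega)
  subst hx
  by_cases hy : y = 0
  · subst hy
    refine ⟨?_, rfl⟩
    have : z ^ (N + 12) = 0 := by simpa using hrel
    exact eq_zero_of_pow_eq_zero this
  · exfalso
    by_cases hz : z = 0
    · subst hz
      have : y ^ (N + 12) = 0 := by simpa [hσ0] using hrel
      exact hy (eq_zero_of_pow_eq_zero this)
    have h1 : 4 * β * z ^ (N + 8) = -(σ * (N + 12) * y ^ (N + 8)) := by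
      refine mul_right_cancel₀ (pow_ne_zero 3 hy) ?_
      linear_combination hder
    have h2 : (N + 12) * z ^ 4 = -(β * (N + 8) * y ^ 4) := by
      refine mul_left_cancel₀ (pow_ne_zero (N + 8) hz) ?_
      linear_combination (N + 12) * hrel - y ^ 4 * h1
    have h3 : 4 * ‖β‖ * ‖z‖ ^ (N + 8) = (N + 12) * ‖y‖ ^ (N + 8) := by
      have := congrArg norm h1
      rw [norm_neg, norm_mul, norm_mul, norm_mul, norm_mul, norm_pow, norm_pow, hσ, one_mul] at this
      have e : ‖((N : ℂ) + 12)‖ = N + 12 := by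
        exact_mod_cast Complex.norm_natCast (N + 12)
      rw [e] at this
      simpa using this
    have h4 : (N + 12) * ‖z‖ ^ 4 = ‖β‖ * (N + 8) * ‖y‖ ^ 4 := by
      have := congrArg norm h2
      rw [norm_neg, norm_mul, norm_mul, norm_mul, norm_pow, norm_pow] at this
      have e : ‖((N : ℂ) + 12)‖ = N + 12 := by
        exact_mod_cast Complex.norm_natCast (N + 12)
      have e' : ‖((N : ℂ) + 8)‖ = N + 8 := by
        exact_mod_cast Complex.norm_natCast (N + 8)
      rwa [e, e'] at this
    have hy0 : 0 < ‖y‖ := norm_pos_iff.2 hy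
    have hz0 : 0 < ‖z‖ := norm_pos_iff.2 hz
    have hNN : (0 : ℝ) ≤ N := Nat.cast_nonneg N
    rcases le_or_gt ‖z‖ ‖y‖ with hle | hlt
    · have h5 : ‖z‖ ^ (N + 8) ≤ ‖y‖ ^ (N + 8) := by gcongr
      have h6 : ‖β‖ * ‖z‖ ^ (N + 8) ≤ 1 * ‖y‖ ^ (N + 8) := by gcongr
      have h7 : 0 < ‖y‖ ^ (N + 8) := by positivity
      nlinarith
    · have h5 : ‖y‖ ^ 4 < ‖z‖ ^ 4 := by gcongr
      have h6 : ‖β‖ * (N + 8) * ‖y‖ ^ 4 ≤ 1 * (N + 8) * ‖y‖ ^ 4 := by gcongr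
      have h7 : 0 ≤ (N : ℝ) * (‖z‖ ^ 4 - ‖y‖ ^ 4) := mul_nonneg hNN (sub_nonneg.2 h5.le)
      have h8 : 0 < ‖z‖ ^ 4 := by positivity
      linarith

/-- A nonconstant curve on the surface satisfying a superelliptic equation in the three coordinates
`0`, `j`, `k` has these three coordinates proportional. -/
theorem wronsk_eq_zero_of_superelliptic {r C : ℝ} {h : ℂ → Fin 4 → ℂ → ℂ} (H : BoundedLifts r C h)
    {N : ℕ} {a b : ℂ} (hY : ∀ c, ∀ z ∈ ball c r, (fun i => h c i z) ∈ surface N a b)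
    {j k : Fin 4} (hj : 0 ≠ j) (hk : 0 ≠ k) (hjk : j ≠ k) {α β σ : ℂ} (hα : α ≠ 0) (hβ : ‖β‖ ≤ 1)
    (hσ : ‖σ‖ = 1)
    (hrel₀ : ∀ z ∈ ball 0 r, h 0 0 z ^ (N + 12) + β * h 0 0 z ^ (N + 8) * h 0 j z ^ 4 +
      σ * h 0 j z ^ (N + 12) + α * h 0 0 z ^ (N + 8) * h 0 k z ^ 4 = 0) :
    (∀ z ∈ ball 0 r, wronsk (h 0 0) (h 0 j) z = 0) ∧
      ∀ z ∈ ball 0 r, wronsk (h 0 0) (h 0 k) z = 0 := by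
  set R : (Fin 4 → ℂ) → ℂ := fun v => v 0 ^ (N + 12) + β * v 0 ^ (N + 8) * v j ^ 4 +
    σ * v j ^ (N + 12) + α * v 0 ^ (N + 8) * v k ^ 4 with hR
  have hRd : Differentiable ℂ R := by fun_prop
  have hrel : ∀ c, ∀ z ∈ ball c r, R (fun i => h c i z) = 0 := by
    refine H.propagate hRd (D := N + 12) (fun t v => ?_) hrel₀
    simp only [hR]
    ring
  set S : (Fin 4 → ℂ) → ℂ := fun v =>
    4 * β * v 0 ^ (N + 8) * v j ^ 3 + σ * (N + 12) * v j ^ (N + 11) with hS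
  have hderiv : ∀ c, ∀ z ∈ ball c r, S (fun i => h c i z) * wronsk (h c 0) (h c j) z =
      -(4 * α * h c 0 z ^ (N + 8) * h c k z ^ 3) * wronsk (h c 0) (h c k) z := by
    intro c z hz
    have d : ∀ i, HasDerivAt (h c i) (deriv (h c i) z) z := fun i =>
      ((H.diff c i).differentiableAt (isOpen_ball.mem_nhds hz)).hasDerivAt
    have h1 : (fun w => R (fun i => h c i w)) =ᶠ[𝓝 z] fun _ => 0 := by
      filter_upwards [isOpen_ball.mem_nhds hz] with w hw using hrel c w hw
    have h2 := h1.deriv_eq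
    rw [deriv_const] at h2
    have h3 : HasDerivAt (fun w => R (fun i => h c i w)) _ z :=
      (((((d 0).fun_pow (N + 12)).fun_add ((((d 0).fun_pow (N + 8)).const_mul β).fun_mul
        ((d j).fun_pow 4))).fun_add (((d j).fun_pow (N + 12)).const_mul σ)).fun_add
        ((((d 0).fun_pow (N + 8)).const_mul α).fun_mul ((d k).fun_pow 4)))
    rw [h3.deriv] at h2
    have h4 := hrel c z hz
    simp only [hR] at h4
    simp only [hS, wronsk]
    simp only [show N + 12 - 1 = N + 11 from rfl,
      show N + 8 - 1 = N + 7 from rfl] at h2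
    push_cast at h2
    linear_combination h c 0 z * h2 - (N + 12) * deriv (h c 0) z * h4
  have key : ∀ s : Fin 4, ∃ K : ℂ, ∀ z ∈ ball 0 r,
      h 0 s z * wronsk (h 0 0) (h 0 j) z = K * h 0 k z ^ 3 := by
    intro s
    have hconst := H.exists_const_of_ratio (κ := Fin 2)
      (Y := surface N a b ∩ {v | R v = 0})
      ((isClosed_surface N a b).inter (isClosed_eq hRd.continuous continuous_const))
      (fun c z hz => ⟨hY c z hz, hrel c z hz⟩)
      (Num := fun n v p _ => if n = 0 then v s * (v 0 * p j - p 0 * v j) else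
        v s * (-(4 * α * v 0 ^ (N + 8)) * (v 0 * p k - p 0 * v k)))
      (Den := fun n v => if n = 0 then v k ^ 3 else S v)
      (fun n => ?_) (fun n => ?_) (fun n => if n = 0 then 3 else N + 11)
      (fun n t l m v p q ht => ?_) (fun n t v => ?_) (fun c z hz => ?_) (fun v hv hv0 => ?_)
    · obtain ⟨K, hK⟩ := hconst
      exact ⟨K, fun z hz => hK 0 z hz 0⟩
    · fin_cases n <;> simp <;> fun_prop
    · fin_cases n <;> simp <;> fun_prop
    · fin_cases n <;> simp <;> ring
    · fin_cases n <;> simp [hS] <;> ring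
    · have h1 := hderiv c z hz
      simp only [wronsk] at h1
      have h2 : h c s z * (h c 0 z * deriv (h c j) z - deriv (h c 0) z * h c j z) *
          S (fun i => h c i z) = h c s z * (-(4 * α * h c 0 z ^ (N + 8)) *
          (h c 0 z * deriv (h c k) z - deriv (h c 0) z * h c k z)) * h c k z ^ 3 := by
        linear_combination h c s z * h1
      intro n n'
      fin_cases n <;> fin_cases n'
      · rfl
      · exact h2
      · exact h2.symm
      · rfl
    · by_contra! hcon
      have h0 : v k = 0 := eq_zero_of_pow_eq_zero (hcon 0)
      obtain ⟨h1, h2⟩ := superelliptic_no_zero hβ hσ h0 hv.2 (hcon 1)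
      exact hv0 (eq_zero_of_mem_surface hv.1 hj hk hjk h1 h2 h0)
  have an := H.analyticOnNhd 0
  have df := H.diff 0
  have hw0j : ∀ z ∈ ball 0 r, wronsk (h 0 0) (h 0 j) z = 0 := by
    obtain ⟨K, hK⟩ := key 0
    obtain ⟨L, hL⟩ := key j
    by_cases hKL : K = 0
    · have h1 : ∀ z ∈ ball 0 r, h 0 0 z * wronsk (h 0 0) (h 0 j) z = 0 := fun z hz => by
        rw [hK z hz, hKL, zero_mul]
      rcases (an 0).eq_zero_or_eq_zero_on_ball ((an 0).wronsk (an j)) h1 with h2 | h2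
      · exact wronsk_eq_zero_of_left isOpen_ball (df 0) (df j) h2
      · exact h2
    · have h1 : ∀ z ∈ ball 0 r, (L * h 0 0 z + -K * h 0 j z) * wronsk (h 0 0) (h 0 j) z = 0 := by
        intro z hz
        linear_combination L * hK z hz - K * hL z hz
      rcases ((analyticOnNhd_const.mul (an 0)).add
        (analyticOnNhd_const.mul (an j))).eq_zero_or_eq_zero_on_ball ((an 0).wronsk (an j)) h1
        with h2 | h2
      · exact wronsk_eq_zero_of_linear isOpen_ball (df 0) (df j) (Or.inr (neg_ne_zero.2 hKL)) h2
      · exact h2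
  refine ⟨hw0j, ?_⟩
  have h1 : ∀ z ∈ ball 0 r, h 0 0 z ^ (N + 8) * (h 0 k z ^ 3 * wronsk (h 0 0) (h 0 k) z) = 0 := by
    intro z hz
    have := hderiv 0 z hz
    rw [hw0j z hz] at this
    refine mul_left_cancel₀ (mul_ne_zero (by norm_num : (4 : ℂ) ≠ 0) hα) ?_
    linear_combination this
  rcases ((an 0).pow (N + 8)).eq_zero_or_eq_zero_on_ball
    (((an k).pow 3).mul ((an 0).wronsk (an k))) h1 with h2 | h2
  · exact wronsk_eq_zero_of_left isOpen_ball (df 0) (df k) fun z hz =>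
      eq_zero_of_pow_eq_zero (h2 z hz)
  rcases ((an k).pow 3).eq_zero_or_eq_zero_on_ball ((an 0).wronsk (an k)) h2 with h3 | h3
  · intro z hz
    rw [wronsk_swap, wronsk_eq_zero_of_left isOpen_ball (df k) (df 0)
      (fun z hz => eq_zero_of_pow_eq_zero (h3 z hz)) z hz, neg_zero]
  · exact h3

theorem term_zero (N : ℕ) (a b : ℂ) (v : Fin 4 → ℂ) :
    term N a b 0 v = v 0 ^ (N + 8) * (v 0 ^ 4 + a * v 1 ^ 4 + b * v 2 ^ 4) := rfl

theorem term_of_ne_zero (N : ℕ) (a b : ℂ) {m : Fin 4} (hm : m ≠ 0) (v : Fin 4 → ℂ) :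
    term N a b m v = v m ^ (N + 12) := by
  simp [term, expo, cofac, hm]

theorem wronsk_eq_zero_of_linear_left {f g k : ℂ → ℂ} {U : Set ℂ} (hU : IsOpen U)
    (hf : DifferentiableOn ℂ f U) (hg : DifferentiableOn ℂ g U) {p q : ℂ} (hq : q ≠ 0)
    (hr : ∀ z ∈ U, p * f z + q * g z = 0) (hfk : ∀ z ∈ U, wronsk f k z = 0) :
    ∀ z ∈ U, wronsk g k z = 0 := by
  intro z hz
  have h1 : (fun z => p * f z + q * g z) =ᶠ[𝓝 z] fun _ => 0 := by
    filter_upwards [hU.mem_nhds hz] with w hw using hr w hw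
  have h2 := h1.deriv_eq
  have hd : ∀ {g : ℂ → ℂ}, DifferentiableOn ℂ g U → HasDerivAt g (deriv g z) z := fun hg =>
    (hg.differentiableAt (hU.mem_nhds hz)).hasDerivAt
  rw [deriv_const, (((hd hf).const_mul p).fun_add ((hd hg).const_mul q)).deriv] at h2
  have h3 := hr z hz
  have h4 := hfk z hz
  unfold wronsk at h4 ⊢
  refine mul_left_cancel₀ hq ?_
  linear_combination deriv k z * h3 - k z * h2 - p * h4

/-- If all terms of the equation are proportional along a curve, then so are the coordinates. -/
theorem wronsk_eq_zero_of_wronsk_term {r C : ℝ} {h : ℂ → Fin 4 → ℂ → ℂ} (H : BoundedLifts r C h)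
    {N : ℕ} {a b : ℂ} (hS : ∀ m n, ∀ z ∈ ball (0 : ℂ) r,
      wronsk (fun z => term N a b m fun i => h 0 i z) (fun z => term N a b n fun i => h 0 i z) z = 0)
    (i j : Fin 4) : ∀ z ∈ ball (0 : ℂ) r, wronsk (h 0 i) (h 0 j) z = 0 := by
  have an := H.analyticOnNhd 0
  have df := H.diff 0
  have hpow : ∀ i j, i ≠ 0 → j ≠ 0 → ∀ z ∈ ball (0 : ℂ) r, wronsk (h 0 i) (h 0 j) z = 0 := by
    intro i j hi hj
    refine wronsk_eq_zero_of_pow isOpen_ball (convex_ball (0 : ℂ) r).isPreconnected (an i) (an j)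
      (n := N + 12) (by omega) fun z hz => ?_
    have := hS i j z hz
    simpa only [term_of_ne_zero N a b hi, term_of_ne_zero N a b hj] using this
  have hN : ((N : ℂ) + 12) ≠ 0 := by exact_mod_cast (show N + 12 ≠ 0 by omega)
  have hzero : ∀ m, m ≠ 0 → ∀ z ∈ ball (0 : ℂ) r, wronsk (h 0 0) (h 0 m) z = 0 := by
    intro m hm
    have h1m := hpow 1 m (by decide) hm
    have h2m := hpow 2 m (by decide) hm
    have d : ∀ z ∈ ball (0 : ℂ) r, ∀ i, HasDerivAt (h 0 i) (deriv (h 0 i) z) z := fun z hz i =>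
      ((df i).differentiableAt (isOpen_ball.mem_nhds hz)).hasDerivAt
    set B : ℂ → ℂ := fun z => (N + 12) * h 0 0 z ^ 4 + (N + 8) * (a * h 0 1 z ^ 4 + b * h 0 2 z ^ 4)
      with hB
    have hBa : AnalyticOnNhd ℂ B (ball 0 r) :=
      (analyticOnNhd_const.mul ((an 0).pow 4)).add (analyticOnNhd_const.mul
        ((analyticOnNhd_const.mul ((an 1).pow 4)).add (analyticOnNhd_const.mul ((an 2).pow 4))))
    have hleft : (∀ z ∈ ball (0 : ℂ) r, h 0 0 z = 0) →
        ∀ z ∈ ball (0 : ℂ) r, wronsk (h 0 0) (h 0 m) z = 0 :=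
      wronsk_eq_zero_of_left isOpen_ball (df 0) (df m)
    have h1 : ∀ z ∈ ball (0 : ℂ) r, h 0 m z ^ (N + 11) *
        (h 0 0 z ^ (N + 7) * (B z * wronsk (h 0 0) (h 0 m) z)) = 0 := by
      intro z hz
      have e := hS 0 m z hz
      unfold wronsk at e
      simp only [term_of_ne_zero N a b hm] at e
      rw [((d z hz m).fun_pow (N + 12)).deriv, (deriv_term N a b 0 isOpen_ball df hz).1] at e
      simp only [term_zero, termDeriv, cofac, cofacDeriv, expo, if_true,
        show N + 12 - 1 = N + 11 from rfl, show N + 8 - 1 = N + 7 from rfl] at e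
      push_cast at e
      have e1 := h1m z hz
      have e2 := h2m z hz
      unfold wronsk at e1 e2 ⊢
      simp only [hB]
      linear_combination e - h 0 m z ^ (N + 11) * h 0 0 z ^ (N + 8) *
        (4 * a * h 0 1 z ^ 3 * e1 + 4 * b * h 0 2 z ^ 3 * e2)
    rcases ((an m).pow (N + 11)).eq_zero_or_eq_zero_on_ball
      (((an 0).pow (N + 7)).mul (hBa.mul ((an 0).wronsk (an m)))) h1 with h2 | h2
    · intro z hz
      rw [wronsk_swap, wronsk_eq_zero_of_left isOpen_ball (df m) (df 0)
        (fun z hz => eq_zero_of_pow_eq_zero (h2 z hz)) z hz, neg_zero]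
    rcases ((an 0).pow (N + 7)).eq_zero_or_eq_zero_on_ball (hBa.mul ((an 0).wronsk (an m))) h2
      with h3 | h3
    · exact hleft fun z hz => eq_zero_of_pow_eq_zero (h3 z hz)
    rcases hBa.eq_zero_or_eq_zero_on_ball ((an 0).wronsk (an m)) h3 with h4 | h4
    · have h5 : ∀ z ∈ ball (0 : ℂ) r, h 0 0 z ^ 3 * wronsk (h 0 0) (h 0 m) z = 0 := by
        intro z hz
        have e : B =ᶠ[𝓝 z] fun _ => 0 := by
          filter_upwards [isOpen_ball.mem_nhds hz] with w hw using h4 w hw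
        have e' := e.deriv_eq
        have hd : HasDerivAt B _ z := (((d z hz 0).fun_pow 4).const_mul ((N : ℂ) + 12)).fun_add
          (((((d z hz 1).fun_pow 4).const_mul a).fun_add
            (((d z hz 2).fun_pow 4).const_mul b)).const_mul ((N : ℂ) + 8))
        rw [deriv_const, hd.deriv] at e'
        push_cast at e'
        have e0 := h4 z hz
        have e1 := h1m z hz
        have e2 := h2m z hz
        simp only [hB] at e0
        unfold wronsk at e1 e2 ⊢
        refine mul_left_cancel₀ (mul_ne_zero (by norm_num : (4 : ℂ) ≠ 0) hN) ?_
        linear_combination 4 * deriv (h 0 m) z * e0 - h 0 m z * e' -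
          4 * (N + 8) * (a * h 0 1 z ^ 3 * e1 + b * h 0 2 z ^ 3 * e2)
      rcases ((an 0).pow 3).eq_zero_or_eq_zero_on_ball ((an 0).wronsk (an m)) h5 with h6 | h6
      · exact hleft fun z hz => eq_zero_of_pow_eq_zero (h6 z hz)
      · exact h6
    · exact h4
  intro z hz
  by_cases hi : i = 0 <;> by_cases hj : j = 0
  · subst hi hj
    unfold wronsk
    ring
  · subst hi
    exact hzero j hj z hz
  · subst hj
    rw [wronsk_swap, hzero i hi z hz, neg_zero]
  · exact hpow i j hi hj z hz

theorem wronsk_pairs_of_six {F : Fin 4 → ℂ → ℂ} {U : Set ℂ} {i j k l : Fin 4}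
    (hijkl : ∀ m, m = i ∨ m = j ∨ m = k ∨ m = l)
    (hij : ∀ z ∈ U, wronsk (F i) (F j) z = 0) (hik : ∀ z ∈ U, wronsk (F i) (F k) z = 0)
    (hil : ∀ z ∈ U, wronsk (F i) (F l) z = 0) (hjk : ∀ z ∈ U, wronsk (F j) (F k) z = 0)
    (hjl : ∀ z ∈ U, wronsk (F j) (F l) z = 0) (hkl : ∀ z ∈ U, wronsk (F k) (F l) z = 0)
    (m n : Fin 4) : ∀ z ∈ U, wronsk (F m) (F n) z = 0 := by
  have hrefl : ∀ m, ∀ z ∈ U, wronsk (F m) (F m) z = 0 := fun m z _ => by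
    unfold wronsk
    ring
  have hsymm : ∀ m n, (∀ z ∈ U, wronsk (F m) (F n) z = 0) → ∀ z ∈ U, wronsk (F n) (F m) z = 0 :=
    fun m n h z hz => by rw [wronsk_swap, h z hz, neg_zero]
  rcases hijkl m with rfl | rfl | rfl | rfl <;> rcases hijkl n with rfl | rfl | rfl | rfl <;>
    first
    | exact hrefl _
    | assumption
    | exact hsymm _ _ (by assumption)

theorem wronsk_term_eq_zero_of_two {r C : ℝ} {h : ℂ → Fin 4 → ℂ → ℂ} (H : BoundedLifts r C h)
    {N : ℕ} {a b : ℂ} (hY : ∀ c, ∀ z ∈ ball c r, (fun i => h c i z) ∈ surface N a b)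
    (hnc : ∃ i j, wronsk (h 0 i) (h 0 j) 0 ≠ 0) {i j k : Fin 4}
    (hijk : ∀ m, m = i ∨ m = j ∨ m = k ∨ m = 3) (hik : i ≠ k) (hi : i ≠ 3) (hk : k ≠ 3)
    (hsum : ∀ v ∈ surface N a b, term N a b 3 v = term N a b i v + term N a b j v + term N a b k v)
    {p q : ℂ} (hq : q ≠ 0) (hpq : p ≠ q) (hrel : ∀ z ∈ ball (0 : ℂ) r,
      p * term N a b i (fun i => h 0 i z) + q * term N a b j (fun i => h 0 i z) = 0) (m n : Fin 4) :
    ∀ z ∈ ball (0 : ℂ) r, wronsk (fun z => term N a b m fun i => h 0 i z)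
      (fun z => term N a b n fun i => h 0 i z) z = 0 := by
  have hT : ∀ m, DifferentiableOn ℂ (fun z => term N a b m fun i => h 0 i z) (ball 0 r) :=
    fun m => (H.analyticOnNhd_term N a b m).differentiableOn
  have he : Function.Injective ![i, k, 3] := by
    intro x y hxy
    fin_cases x <;> fin_cases y <;> simp_all
  have hγ : ∀ n, ![q - p, q, -q] n ≠ 0 := by
    intro n
    fin_cases n <;> simp [sub_eq_zero, hq, hpq.symm]
  have h3 := wronsk_term_eq_zero_of_three H hY hnc he hγ
    (H.propagate_term fun z hz => by
      simp only [Fin.sum_univ_three, Matrix.cons_val]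
      linear_combination -q * hsum _ (hY 0 z hz) - hrel z hz)
  have hik' := h3 0
  have hk3 := h3 1
  have h3i := h3 2
  simp only [Fin.isValue, zero_add, Matrix.cons_val, Fin.reduceAdd] at hik' hk3 h3i
  have hi3 : ∀ z ∈ ball (0 : ℂ) r, wronsk (fun z => term N a b i fun i => h 0 i z)
      (fun z => term N a b 3 fun i => h 0 i z) z = 0 := fun z hz => by
    rw [wronsk_swap, h3i z hz, neg_zero]
  exact wronsk_pairs_of_six (F := fun m z => term N a b m fun i => h 0 i z) hijk
    (wronsk_eq_zero_of_linear isOpen_ball (hT i) (hT j) (Or.inr hq) hrel) hik' hi3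
    (wronsk_eq_zero_of_linear_left isOpen_ball (hT i) (hT j) hq hrel hik')
    (wronsk_eq_zero_of_linear_left isOpen_ball (hT i) (hT j) hq hrel hi3) hk3 m n

theorem wronsk_term_eq_zero_or {r C : ℝ} {h : ℂ → Fin 4 → ℂ → ℂ} (H : BoundedLifts r C h)
    {N : ℕ} {a b : ℂ} (hY : ∀ c, ∀ z ∈ ball c r, (fun i => h c i z) ∈ surface N a b)
    (hnc : ∃ i j, wronsk (h 0 i) (h 0 j) 0 ≠ 0) {i j k : Fin 4}
    (hijk : ∀ m, m = i ∨ m = j ∨ m = k ∨ m = 3) (hik : i ≠ k) (hjk : j ≠ k) (hi : i ≠ 3)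
    (hj : j ≠ 3) (hk : k ≠ 3)
    (hsum : ∀ v ∈ surface N a b, term N a b 3 v = term N a b i v + term N a b j v + term N a b k v)
    {p q : ℂ} (hpq : p ≠ 0 ∨ q ≠ 0) (hrel : ∀ z ∈ ball (0 : ℂ) r,
      p * term N a b i (fun i => h 0 i z) + q * term N a b j (fun i => h 0 i z) = 0) :
    (∀ m n, ∀ z ∈ ball (0 : ℂ) r, wronsk (fun z => term N a b m fun i => h 0 i z)
      (fun z => term N a b n fun i => h 0 i z) z = 0) ∨
    ∀ z ∈ ball (0 : ℂ) r, term N a b i (fun i => h 0 i z) + term N a b j (fun i => h 0 i z) = 0 ∧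
      term N a b k (fun i => h 0 i z) = term N a b 3 (fun i => h 0 i z) := by
  by_cases hpq' : p = q
  · subst hpq'
    have hp : p ≠ 0 := by simpa using hpq
    refine Or.inr fun z hz => ?_
    have h1 : term N a b i (fun i => h 0 i z) + term N a b j (fun i => h 0 i z) = 0 :=
      mul_left_cancel₀ hp (by linear_combination hrel z hz)
    exact ⟨h1, by linear_combination -hsum _ (hY 0 z hz) - h1⟩
  · left
    by_cases hq : q = 0
    · have hp : p ≠ 0 := by simpa [hq] using hpq
      refine wronsk_term_eq_zero_of_two H hY hnc (i := j) (j := i) (k := k)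
        (fun m => by rcases hijk m with h | h | h | h <;> simp [h]) hjk hj hk
        (fun v hv => by rw [hsum v hv]; ring) hp (Ne.symm hpq') fun z hz => ?_
      linear_combination hrel z hz
    · exact wronsk_term_eq_zero_of_two H hY hnc hijk hik hi hk hsum hq hpq' hrel

/-- Along a nonconstant curve on the surface, either all terms of the equation are proportional or
two of the first three terms cancel. -/
theorem wronsk_term_eq_zero_or_cancel {r C : ℝ} {h : ℂ → Fin 4 → ℂ → ℂ} (H : BoundedLifts r C h)
    {N : ℕ} (hN : N ≠ 0) {a b : ℂ} (hY : ∀ c, ∀ z ∈ ball c r, (fun i => h c i z) ∈ surface N a b)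
    (hnc : ∃ i j, wronsk (h 0 i) (h 0 j) 0 ≠ 0) :
    (∀ m n, ∀ z ∈ ball (0 : ℂ) r, wronsk (fun z => term N a b m fun i => h 0 i z)
      (fun z => term N a b n fun i => h 0 i z) z = 0) ∨
    ∃ i j k : Fin 4, (i, j, k) ∈ ({(0, 1, 2), (0, 2, 1), (1, 2, 0)} : Set (Fin 4 × Fin 4 × Fin 4)) ∧
      ∀ z ∈ ball (0 : ℂ) r, term N a b i (fun i => h 0 i z) + term N a b j (fun i => h 0 i z) = 0 ∧
        term N a b k (fun i => h 0 i z) = term N a b 3 (fun i => h 0 i z) := by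
  obtain ⟨α, β, γ, h0, hrel⟩ := exists_linear_relation_term H hN hY hnc
  by_cases hγ : γ = 0
  · refine (wronsk_term_eq_zero_or H hY hnc (i := 0) (j := 1) (k := 2) (by decide) (by decide)
      (by decide) (by decide) (by decide) (by decide) (fun v hv => hv) (p := α) (q := β)
      (by simpa [hγ] using h0) fun z hz => ?_).imp_right fun h1 => ⟨0, 1, 2, by simp, h1⟩
    linear_combination hrel z hz - term N a b 2 (fun i => h 0 i z) * hγ
  by_cases hβ : β = 0
  · refine (wronsk_term_eq_zero_or H hY hnc (i := 0) (j := 2) (k := 1) (by decide) (by decide)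
      (by decide) (by decide) (by decide) (by decide) (fun v (hv : _ = _) => by rw [hv]; ring)
      (p := α) (q := γ) (Or.inr hγ) fun z hz => ?_).imp_right fun h1 => ⟨0, 2, 1, by simp, h1⟩
    linear_combination hrel z hz - term N a b 1 (fun i => h 0 i z) * hβ
  by_cases hα : α = 0
  · refine (wronsk_term_eq_zero_or H hY hnc (i := 1) (j := 2) (k := 0) (by decide) (by decide)
      (by decide) (by decide) (by decide) (by decide) (fun v (hv : _ = _) => by rw [hv]; ring)
      (p := β) (q := γ) (Or.inr hγ) fun z hz => ?_).imp_right fun h1 => ⟨1, 2, 0, by simp, h1⟩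
    linear_combination hrel z hz - term N a b 0 (fun i => h 0 i z) * hα
  left
  have hT : ∀ m, DifferentiableOn ℂ (fun z => term N a b m fun i => h 0 i z) (ball 0 r) :=
    fun m => (H.analyticOnNhd_term N a b m).differentiableOn
  have h3 := wronsk_term_eq_zero_of_three H hY hnc (e := ![0, 1, 2]) (by decide)
    (γ := ![α, β, γ]) (fun n => by fin_cases n <;> simpa)
    (H.propagate_term fun z hz => by
      simp only [Fin.sum_univ_three, Matrix.cons_val]
      exact hrel z hz)
  have h01 := h3 0
  have h12 := h3 1
  have h20 := h3 2
  simp only [Fin.isValue, zero_add, Matrix.cons_val, Fin.reduceAdd] at h01 h12 h20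
  have h02 : ∀ z ∈ ball (0 : ℂ) r, wronsk (fun z => term N a b 0 fun i => h 0 i z)
      (fun z => term N a b 2 fun i => h 0 i z) z = 0 := fun z hz => by
    rw [wronsk_swap, h20 z hz, neg_zero]
  have hsum : ∀ w ∈ ball (0 : ℂ) r, term N a b 3 (fun i => h 0 i w) =
      term N a b 0 (fun i => h 0 i w) + term N a b 1 (fun i => h 0 i w) +
      term N a b 2 (fun i => h 0 i w) := hY 0
  have hlast : ∀ z ∈ ball (0 : ℂ) r, ∀ f, wronsk f (fun z => term N a b 3 fun i => h 0 i z) z =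
      wronsk f (fun z => term N a b 0 fun i => h 0 i z) z +
      wronsk f (fun z => term N a b 1 fun i => h 0 i z) z +
      wronsk f (fun z => term N a b 2 fun i => h 0 i z) z := by
    intro z hz f
    have h1 := deriv_eq_add_three isOpen_ball (hT 0) (hT 1) (hT 2) hsum hz
    have h2 := hsum z hz
    unfold wronsk
    linear_combination f z * h1 - deriv f z * h2
  have hself : ∀ (f : ℂ → ℂ) z, wronsk f f z = 0 := fun f z => by
    unfold wronsk
    ring
  refine wronsk_pairs_of_six (F := fun m z => term N a b m fun i => h 0 i z)
    (i := 0) (j := 1) (k := 2) (l := 3) (by decide) h01 h02 (fun z hz => ?_) h12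
    (fun z hz => ?_) (fun z hz => ?_)
  · rw [hlast z hz, hself, h01 z hz, h02 z hz]
    ring
  · rw [hlast z hz, hself, wronsk_swap, h01 z hz, h12 z hz]
    ring
  · rw [hlast z hz, hself, h20 z hz, wronsk_swap _ (fun z => term N a b 1 fun i => h 0 i z),
      h12 z hz]
    ring

theorem wronsk_eq_zero_trans {f g k : ℂ → ℂ} {c : ℂ} {r : ℝ} (hf : AnalyticOnNhd ℂ f (ball c r))
    (hg : AnalyticOnNhd ℂ g (ball c r)) (hk : AnalyticOnNhd ℂ k (ball c r))
    (hfg : ∀ z ∈ ball c r, wronsk f g z = 0) (hgk : ∀ z ∈ ball c r, wronsk g k z = 0) :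
    (∀ z ∈ ball c r, g z = 0) ∨ ∀ z ∈ ball c r, wronsk f k z = 0 := by
  refine hg.eq_zero_or_eq_zero_on_ball (hf.wronsk hk) fun z hz => ?_
  have h1 := hfg z hz
  have h2 := hgk z hz
  unfold wronsk at *
  linear_combination f z * h2 + k z * h1

theorem wronsk_eq_zero_of_path {F : Fin 4 → ℂ → ℂ} {r : ℝ}
    (hF : ∀ i, AnalyticOnNhd ℂ (F i) (ball 0 r)) {i j k l : Fin 4}
    (hijkl : ∀ m, m = i ∨ m = j ∨ m = k ∨ m = l)
    (hij : ∀ z ∈ ball (0 : ℂ) r, wronsk (F i) (F j) z = 0)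
    (hik : ∀ z ∈ ball (0 : ℂ) r, wronsk (F i) (F k) z = 0)
    (hkl : ∀ z ∈ ball (0 : ℂ) r, wronsk (F k) (F l) z = 0)
    (hi0 : (∀ z ∈ ball (0 : ℂ) r, F i z = 0) → ∀ z ∈ ball (0 : ℂ) r, F j z = 0)
    (hk0 : (∀ z ∈ ball (0 : ℂ) r, F k z = 0) → ∀ z ∈ ball (0 : ℂ) r, F l z = 0)
    (m n : Fin 4) : ∀ z ∈ ball (0 : ℂ) r, wronsk (F m) (F n) z = 0 := by
  have hzero : ∀ m n, (∀ z ∈ ball (0 : ℂ) r, F m z = 0) →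
      ∀ z ∈ ball (0 : ℂ) r, wronsk (F m) (F n) z = 0 := fun m n =>
    wronsk_eq_zero_of_left isOpen_ball (hF m).differentiableOn (hF n).differentiableOn
  have hsymm : ∀ m n, (∀ z ∈ ball (0 : ℂ) r, wronsk (F m) (F n) z = 0) →
      ∀ z ∈ ball (0 : ℂ) r, wronsk (F n) (F m) z = 0 :=
    fun m n h z hz => by rw [wronsk_swap, h z hz, neg_zero]
  have hjk : ∀ z ∈ ball (0 : ℂ) r, wronsk (F j) (F k) z = 0 := by
    rcases wronsk_eq_zero_trans (hF j) (hF i) (hF k) (hsymm _ _ hij) hik with h1 | h1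
    · exact hzero _ _ (hi0 h1)
    · exact h1
  have hthrough : ∀ m, (∀ z ∈ ball (0 : ℂ) r, wronsk (F m) (F k) z = 0) →
      ∀ z ∈ ball (0 : ℂ) r, wronsk (F m) (F l) z = 0 := by
    intro m hm
    rcases wronsk_eq_zero_trans (hF m) (hF k) (hF l) hm hkl with h1 | h1
    · exact hsymm _ _ (hzero _ _ (hk0 h1))
    · exact h1
  exact wronsk_pairs_of_six hijkl hij hik (hthrough i hik) hjk (hthrough j hjk) hkl m n

/-- There are no nonconstant curves on the surface. -/
theorem wronsk_eq_zero_of_mem_surface {r C : ℝ} {h : ℂ → Fin 4 → ℂ → ℂ} (H : BoundedLifts r C h)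
    {N : ℕ} (hN : N ≠ 0) {a b : ℂ} (ha : a ≠ 0) (hab : ‖a‖ < ‖b‖) (hb : ‖b‖ ≤ 1)
    (hY : ∀ c, ∀ z ∈ ball c r, (fun i => h c i z) ∈ surface N a b) (i j : Fin 4) :
    wronsk (h 0 i) (h 0 j) 0 = 0 := by
  by_contra hne
  have hnc : ∃ i j, wronsk (h 0 i) (h 0 j) 0 ≠ 0 := ⟨i, j, hne⟩
  have an := H.analyticOnNhd 0
  have df := H.diff 0
  have hb0 : b ≠ 0 := norm_pos_iff.1 ((norm_nonneg a).trans_lt hab)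
  suffices hall : ∀ z ∈ ball (0 : ℂ) r, wronsk (h 0 i) (h 0 j) z = 0 from
    hne (hall 0 (mem_ball_self H.pos))
  have hpow : ∀ {f g : ℂ → ℂ}, AnalyticOnNhd ℂ f (ball 0 r) → AnalyticOnNhd ℂ g (ball 0 r) →
      ∀ {p q : ℂ}, (p ≠ 0 ∨ q ≠ 0) →
      (∀ z ∈ ball (0 : ℂ) r, p * f z ^ (N + 12) + q * g z ^ (N + 12) = 0) →
      ∀ z ∈ ball (0 : ℂ) r, wronsk f g z = 0 := fun hf hg p q hpq hr =>
    wronsk_eq_zero_of_pow isOpen_ball (convex_ball (0 : ℂ) r).isPreconnected hf hg (n := N + 12)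
      (by omega) (wronsk_eq_zero_of_linear isOpen_ball (hf.pow (N + 12)).differentiableOn
        (hg.pow (N + 12)).differentiableOn hpq hr)
  have h2 : (2 : Fin 4) ≠ 0 := by decide
  have h3 : (3 : Fin 4) ≠ 0 := by decide
  rcases wronsk_term_eq_zero_or_cancel H hN hY hnc with hS | ⟨i', j', k', hijk, hB⟩
  · exact wronsk_eq_zero_of_wronsk_term H hS i j
  simp only [Set.mem_insert_iff, Set.mem_singleton_iff, Prod.mk.injEq] at hijk
  rcases hijk with ⟨rfl, rfl, rfl⟩ | ⟨rfl, rfl, rfl⟩ | ⟨rfl, rfl, rfl⟩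
  · simp only [term_zero, term_of_ne_zero N a b one_ne_zero, term_of_ne_zero N a b h2,
      term_of_ne_zero N a b h3] at hB
    obtain ⟨h01, h02⟩ := wronsk_eq_zero_of_superelliptic H hY (j := 1) (k := 2) (by decide)
      (by decide) (by decide) hb0 (hab.le.trans hb) norm_one
      fun z hz => by linear_combination (hB z hz).1
    refine wronsk_eq_zero_of_path an (i := 0) (j := 1) (k := 2) (l := 3) (by decide) h01 h02
      (hpow (an 2) (an 3) (p := 1) (q := -1) (Or.inl one_ne_zero)
        fun z hz => by linear_combination (hB z hz).2)
      (fun h0 z hz => eq_zero_of_pow_eq_zero (n := N + 12) ?_)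
      (fun h0 z hz => eq_zero_of_pow_eq_zero (n := N + 12) ?_) i j
    · linear_combination (hB z hz).1 - h 0 0 z ^ (N + 7) *
        (h 0 0 z ^ 4 + a * h 0 1 z ^ 4 + b * h 0 2 z ^ 4) * h0 z hz
    · linear_combination h 0 2 z ^ (N + 11) * h0 z hz - (hB z hz).2
  · simp only [term_zero, term_of_ne_zero N a b one_ne_zero, term_of_ne_zero N a b h2,
      term_of_ne_zero N a b h3] at hB
    obtain ⟨h02, h01⟩ := wronsk_eq_zero_of_superelliptic H hY (j := 2) (k := 1) (by decide)
      (by decide) (by decide) ha hb norm_one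
      fun z hz => by linear_combination (hB z hz).1
    refine wronsk_eq_zero_of_path an (i := 0) (j := 2) (k := 1) (l := 3) (by decide) h02 h01
      (hpow (an 1) (an 3) (p := 1) (q := -1) (Or.inl one_ne_zero)
        fun z hz => by linear_combination (hB z hz).2)
      (fun h0 z hz => eq_zero_of_pow_eq_zero (n := N + 12) ?_)
      (fun h0 z hz => eq_zero_of_pow_eq_zero (n := N + 12) ?_) i j
    · linear_combination (hB z hz).1 - h 0 0 z ^ (N + 7) *
        (h 0 0 z ^ 4 + a * h 0 1 z ^ 4 + b * h 0 2 z ^ 4) * h0 z hz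
    · linear_combination h 0 1 z ^ (N + 11) * h0 z hz - (hB z hz).2
  · simp only [term_zero, term_of_ne_zero N a b one_ne_zero, term_of_ne_zero N a b h2,
      term_of_ne_zero N a b h3] at hB
    have h12 := hpow (an 1) (an 2) (p := 1) (q := 1) (Or.inl one_ne_zero)
      fun z hz => by linear_combination (hB z hz).1
    have hP0 : (∀ z ∈ ball (0 : ℂ) r, h 0 0 z = 0) → ∀ z ∈ ball (0 : ℂ) r, h 0 3 z = 0 := by
      refine fun h0 z hz => eq_zero_of_pow_eq_zero (n := N + 12) ?_
      linear_combination h 0 0 z ^ (N + 7) *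
        (h 0 0 z ^ 4 + a * h 0 1 z ^ 4 + b * h 0 2 z ^ 4) * h0 z hz - (hB z hz).2
    have hP2 : (∀ z ∈ ball (0 : ℂ) r, h 0 2 z = 0) → ∀ z ∈ ball (0 : ℂ) r, h 0 1 z = 0 := by
      refine fun h0 z hz => eq_zero_of_pow_eq_zero (n := N + 12) ?_
      linear_combination (hB z hz).1 - h 0 2 z ^ (N + 11) * h0 z hz
    by_cases hz2 : ∀ z ∈ ball (0 : ℂ) r, h 0 2 z = 0
    · have hz1 := hP2 hz2
      refine wronsk_eq_zero_of_path an (i := 0) (j := 3) (k := 1) (l := 2) (by decide) ?_ ?_ h12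
        hP0 (fun _ => hz2) i j
      · refine hpow (an 0) (an 3) (p := 1) (q := -1) (Or.inl one_ne_zero) fun z hz => ?_
        linear_combination (hB z hz).2 - h 0 0 z ^ (N + 8) *
          (a * h 0 1 z ^ 3 * hz1 z hz + b * h 0 2 z ^ 3 * hz2 z hz)
      · intro z hz
        rw [wronsk_swap, wronsk_eq_zero_of_left isOpen_ball (df 1) (df 0) hz1 z hz, neg_zero]
    · push Not at hz2
      obtain ⟨w, hw, hw0⟩ := hz2
      obtain ⟨p, q, hpq, hlin⟩ := exists_linear_relation_of_wronsk isOpen_ball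
        (convex_ball (0 : ℂ) r).isPreconnected (an 1) (an 2) h12
      have hp : p ≠ 0 := by
        rintro rfl
        have := hlin w hw
        simp_all
      obtain ⟨μ, hμ⟩ : ∃ μ : ℂ, ∀ z ∈ ball (0 : ℂ) r, h 0 1 z = μ * h 0 2 z := by
        refine ⟨-q / p, fun z hz => ?_⟩
        field_simp
        linear_combination hlin z hz
      have hμ1 : ‖μ‖ = 1 := by
        have h1 : μ ^ (N + 12) = -1 := by
          refine mul_right_cancel₀ (pow_ne_zero (N + 12) hw0) ?_
          have := (hB w hw).1
          rw [hμ w hw, mul_pow] at this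
          linear_combination this
        have h2 := congrArg norm h1
        rw [norm_pow, norm_neg, norm_one] at h2
        exact (pow_eq_one_iff_of_nonneg (norm_nonneg μ) (by omega)).1 h2
      have hα : a * μ ^ 4 + b ≠ 0 := by
        intro h0
        have h1 : ‖a * μ ^ 4‖ = ‖b‖ := by rw [eq_neg_of_add_eq_zero_left h0, norm_neg]
        rw [norm_mul, norm_pow, hμ1, one_pow, mul_one] at h1
        exact hab.ne h1
      obtain ⟨h03, h02⟩ := wronsk_eq_zero_of_superelliptic H hY (j := 3) (k := 2) (by decide)
        (by decide) (by decide) hα (β := 0) (σ := -1) (by simp) (by simp) fun z hz => by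
          have := (hB z hz).2
          rw [hμ z hz] at this
          linear_combination this
      exact wronsk_eq_zero_of_path an (i := 0) (j := 3) (k := 2) (l := 1) (by decide) h03 h02
        (fun z hz => by rw [wronsk_swap, h12 z hz, neg_zero]) hP0 hP2 i j

/-- Entire functions with pairwise vanishing Wronskians are proportional to one of them. -/
theorem exists_proportional_of_wronsk {ι : Type*} {f : ι → ℂ → ℂ}
    (hf : ∀ i, Differentiable ℂ (f i)) {l : ι} (hl : f l 0 ≠ 0)
    (hw : ∀ i j z, wronsk (f i) (f j) z = 0) : ∃ c : ι → ℂ, ∀ i z, f i z = c i * f l z := by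
  have an : ∀ i, AnalyticOnNhd ℂ (f i) univ := fun i =>
    (hf i).differentiableOn.analyticOnNhd isOpen_univ
  have key : ∀ i, ∃ c : ℂ, ∀ z, f i z = c * f l z := by
    intro i
    obtain ⟨α, β, h0, hr⟩ := exists_linear_relation_of_wronsk isOpen_univ isPreconnected_univ
      (an i) (an l) fun z _ => hw i l z
    have hα : α ≠ 0 := by
      rintro rfl
      have := hr 0 (mem_univ 0)
      simp_all
    refine ⟨-β / α, fun z => ?_⟩
    have := hr z (mem_univ z)
    field_simp
    linear_combination this
  choose c hc using key
  exact ⟨c, hc⟩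

theorem norm_le_norm_of_partial_eq_zero {N : ℕ} {a x z : ℂ} (ha : ‖a‖ ≤ 1)
    (h : 4 * a * z ^ (N + 8) * x ^ 3 + (N + 12) * x ^ (N + 11) = 0) : ‖x‖ ≤ ‖z‖ := by
  by_contra! hlt
  have hx : x ≠ 0 := norm_pos_iff.1 ((norm_nonneg z).trans_lt hlt)
  have h1 : 4 * a * z ^ (N + 8) = -((N + 12) * x ^ (N + 8)) := by
    refine mul_right_cancel₀ (pow_ne_zero 3 hx) ?_
    linear_combination h
  have e : ‖((N : ℂ) + 12)‖ = N + 12 := by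
    exact_mod_cast Complex.norm_natCast (N + 12)
  have h2 := congrArg norm h1
  rw [norm_neg, norm_mul, norm_mul, norm_mul, norm_pow, norm_pow, e] at h2
  have h3 : ‖z‖ ^ (N + 8) ≤ ‖x‖ ^ (N + 8) := by gcongr
  have h4 : ‖a‖ * ‖z‖ ^ (N + 8) ≤ 1 * ‖x‖ ^ (N + 8) := by gcongr
  have h5 : 0 < ‖x‖ ^ (N + 8) := pow_pos (norm_pos_iff.2 hx) _
  have h6 : 0 ≤ (N : ℝ) * ‖x‖ ^ (N + 8) := by positivity
  have e4 : ‖(4 : ℂ)‖ = 4 := by norm_num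
  rw [e4] at h2
  linarith

theorem eq_zero_of_partials_eq_zero {N : ℕ} {a b x y z : ℂ} (hab : ‖a‖ + ‖b‖ ≤ 1)
    (hz : (N + 12) * z ^ (N + 11) + (N + 8) * z ^ (N + 7) * (a * x ^ 4 + b * y ^ 4) = 0)
    (hx : 4 * a * z ^ (N + 8) * x ^ 3 + (N + 12) * x ^ (N + 11) = 0)
    (hy : 4 * b * z ^ (N + 8) * y ^ 3 + (N + 12) * y ^ (N + 11) = 0) : x = 0 ∧ y = 0 ∧ z = 0 := by
  have h1 := norm_le_norm_of_partial_eq_zero (by linarith [norm_nonneg b]) hx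
  have h2 := norm_le_norm_of_partial_eq_zero (by linarith [norm_nonneg a]) hy
  have hz0 : z = 0 := by
    by_contra hz0
    have h3 : (N + 12) * z ^ 4 = -((N + 8) * (a * x ^ 4 + b * y ^ 4)) := by
      refine mul_left_cancel₀ (pow_ne_zero (N + 7) hz0) ?_
      linear_combination hz
    have e : ‖((N : ℂ) + 12)‖ = N + 12 := by
      exact_mod_cast Complex.norm_natCast (N + 12)
    have e' : ‖((N : ℂ) + 8)‖ = N + 8 := by
      exact_mod_cast Complex.norm_natCast (N + 8)
    have h4 := congrArg norm h3
    rw [norm_neg, norm_mul, norm_mul, norm_pow, e, e'] at h4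
    have h5 : ‖a * x ^ 4 + b * y ^ 4‖ ≤ 1 * ‖z‖ ^ 4 := by
      calc _ ≤ ‖a‖ * ‖x‖ ^ 4 + ‖b‖ * ‖y‖ ^ 4 := by
            refine (norm_add_le _ _).trans_eq ?_
            simp only [norm_mul, norm_pow]
        _ ≤ ‖a‖ * ‖z‖ ^ 4 + ‖b‖ * ‖z‖ ^ 4 := by gcongr
        _ = (‖a‖ + ‖b‖) * ‖z‖ ^ 4 := by ring
        _ ≤ _ := by gcongr
    have h6 : ((N : ℝ) + 8) * ‖a * x ^ 4 + b * y ^ 4‖ ≤ (N + 8) * (1 * ‖z‖ ^ 4) := by gcongr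
    have h7 : 0 < ‖z‖ ^ 4 := pow_pos (norm_pos_iff.2 hz0) _
    linarith
  refine ⟨?_, ?_, hz0⟩
  · simpa [hz0] using h1
  · simpa [hz0] using h2

/-- The branch curve of the cyclic cover of the plane. -/
noncomputable def branchPoly (N : ℕ) (a b : ℂ) : MvPolynomial (Fin 3) ℂ :=
  X 0 ^ (N + 8) * (X 0 ^ 4 + C a * X 1 ^ 4 + C b * X 2 ^ 4) + X 1 ^ (N + 12) + X 2 ^ (N + 12)

theorem isHomogeneous_branchPoly (N : ℕ) (a b : ℂ) : (branchPoly N a b).IsHomogeneous (N + 12) := by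
  have h : ∀ (i : Fin 3) n, (X i ^ n : MvPolynomial (Fin 3) ℂ).IsHomogeneous n := fun i n =>
    isHomogeneous_X_pow i n
  have hC : ∀ (c : ℂ) (i : Fin 3), (C c * X i ^ 4 : MvPolynomial (Fin 3) ℂ).IsHomogeneous 4 :=
    fun c i => by simpa using (isHomogeneous_C (Fin 3) c).mul (h i 4)
  exact (((h 0 (N + 8)).mul (((h 0 4).add (hC a 1)).add (hC b 2))).add (h 1 (N + 12))).add
    (h 2 (N + 12))

theorem rename_branchPoly (N : ℕ) (a b : ℂ) :
    rename Fin.castSucc (branchPoly N a b) = (X 0 ^ (N + 8) * (X 0 ^ 4 + C a * X 1 ^ 4 +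
      C b * X 2 ^ 4) + X 1 ^ (N + 12) + X 2 ^ (N + 12) : MvPolynomial (Fin 4) ℂ) := by
  simp only [branchPoly, map_add, map_mul, map_pow, rename_X, rename_C]
  rfl

theorem isSmooth_branchPoly {N : ℕ} {a b : ℂ} (hab : ‖a‖ + ‖b‖ ≤ 1) :
    IsSmoothHypersurface (X (Fin.last 3) ^ (N + 12) - rename Fin.castSucc (branchPoly N a b)) := by
  intro x hx0 _
  by_contra! hd
  have hN : ((N : ℂ) + 12) ≠ 0 := by exact_mod_cast (show N + 12 ≠ 0 by omega)
  rw [rename_branchPoly] at hd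
  have h0 := hd 0
  have h1 := hd 1
  have h2 := hd 2
  have h3 := hd 3
  simp [pderiv_X, Derivation.leibniz, Derivation.leibniz_pow, Fin.ext_iff]
    at h0 h1 h2 h3
  obtain ⟨e1, e2, e0⟩ := eq_zero_of_partials_eq_zero (N := N) (x := x 1) (y := x 2) (z := x 0) hab
    (by linear_combination -h0) (by linear_combination -h1) (by linear_combination -h2)
  refine hx0 (funext fun i => ?_)
  fin_cases i
  exacts [e0, e1, e2, h3.resolve_left hN]

theorem isBrodyHyperbolic_branchPoly {N : ℕ} (hN : N ≠ 0) {a b : ℂ} (ha : a ≠ 0)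
    (hab : ‖a‖ < ‖b‖) (hb : ‖b‖ ≤ 1) : IsBrodyHyperbolicHypersurface
      (X (Fin.last 3) ^ (N + 12) - rename Fin.castSucc (branchPoly N a b)) := by
  intro f hf hf0 hF
  have hmem : ∀ z, (fun i => f i z) ∈ surface N a b := by
    intro z
    have h := hF z
    rw [rename_branchPoly] at h
    simp only [map_sub, map_add, map_mul, map_pow, eval_X, eval_C] at h
    change term N a b 3 _ = _
    rw [term_zero, term_of_ne_zero N a b one_ne_zero,
      term_of_ne_zero N a b (show (2 : Fin 4) ≠ 0 by decide),
      term_of_ne_zero N a b (show (3 : Fin 4) ≠ 0 by decide)]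
    rw [show Fin.last 3 = 3 from rfl] at h
    linear_combination h
  by_cases hw : ∀ i j z, wronsk (f i) (f j) z = 0
  · obtain ⟨l, hl⟩ := hf0 0
    obtain ⟨c, hc⟩ := exists_proportional_of_wronsk hf hl hw
    exact ⟨c, f l, hf l, hc⟩
  · push Not at hw
    obtain ⟨i, j, z, hz⟩ := hw
    obtain ⟨r, C, h, H, ⟨i', j', hne⟩, hY⟩ := exists_boundedLifts hf hf0 hz
    exact absurd (wronsk_eq_zero_of_mem_surface H hN ha hab hb
      (hY _ (isClosed_surface N a b) (fun t v hv => surface_smul hv t) hmem) i' j') hne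

end Helpers

/-- Theorem 4.4: for `d ≥ 3`, `k ≥ 5` and `δ = dk` there exists a smooth Brody
hyperbolic surface `X_δ = {z₃^δ = G(z₀, z₁, z₂)}` of degree `δ` in ℙ³ that is a
cyclic cover of ℙ² under a linear projection. -/
theorem exists_hyperbolic_surface_cyclic_cover_P2
    (d k δ : ℕ) (hd : 3 ≤ d) (hk : 5 ≤ k) (hδ : δ = d * k) :
    ∃ G : MvPolynomial (Fin 3) ℂ, G.IsHomogeneous δ ∧
      IsSmoothHypersurface
        (X (Fin.last 3) ^ δ - rename Fin.castSucc G : MvPolynomial (Fin 4) ℂ) ∧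
      IsBrodyHyperbolicHypersurface
        (X (Fin.last 3) ^ δ - rename Fin.castSucc G : MvPolynomial (Fin 4) ℂ) := by
  have h15 : 3 * 5 ≤ δ := hδ ▸ Nat.mul_le_mul hd hk
  obtain ⟨N, rfl⟩ : ∃ N, δ = N + 12 := ⟨δ - 12, by omega⟩
  refine ⟨branchPoly N (1 / 4) (1 / 2), isHomogeneous_branchPoly N _ _, isSmooth_branchPoly ?_,
    isBrodyHyperbolic_branchPoly (by omega) ?_ ?_ ?_⟩ <;> norm_num
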